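/- arXiv:1311.1409 — 3 statements merged into one kernel-verified Lean document; each statement's English description precedes it below -/
import Mathlib

section
/- Let r ≥ 3 and let m, t be positive integers satisfying C(t−1,r) ≤ m ≤ C(t−1,r) + C(t−2,r−1) − 2^{r−2}(C(t−2,r−2) − 1). If G is an r-uniform hypergraph on t vertices with m edges containing a clique of order t−2, then λ(G) ≤ λ([t−1]^{(r)}). -/
open Finset

/-- The polynomial λ(G, w) = Σ_{e ∈ E} Π_{i ∈ e} w i. -/
def lagPoly (E : Finset (Finset ℕ)) (w : ℕ → ℝ) : ℝ :=
  ∑ e ∈ E, ∏ i ∈ e, w i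

/-- A feasible weighting on vertex set [n] = {0, …, n-1}. -/
def IsWeighting (n : ℕ) (w : ℕ → ℝ) : Prop :=
  (∀ i, 0 ≤ w i) ∧ (∀ i, n ≤ i → w i = 0) ∧ ∑ i ∈ Finset.range n, w i = 1

/-- The Lagrangian of a hypergraph with edge set `E`. -/
noncomputable def lag (E : Finset (Finset ℕ)) : ℝ :=
  sSup {x | ∃ n w, IsWeighting n w ∧ x = lagPoly E w}

/-- The complete r-uniform hypergraph on vertex set {0, …, t-1}. -/
def completeG (t r : ℕ) : Finset (Finset ℕ) :=
  (Finset.range t).powersetCard r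

lemma sum_powersetCard_insert_aux {a : ℕ} {s : Finset ℕ} (ha : a ∉ s) (k : ℕ)
    (f : Finset ℕ → ℝ) :
    ∑ A ∈ (insert a s).powersetCard (k+1), f A =
      ∑ A ∈ s.powersetCard (k+1), f A + ∑ A ∈ s.powersetCard k, f (insert a A) := by
  rw [Finset.powersetCard_succ_insert ha, Finset.sum_union, Finset.sum_image]
  · intro A hA B hB h
    have h1 : a ∉ A := fun h => ha ((Finset.mem_powersetCard.1 hA).1 h)
    have h2 : a ∉ B := fun h => ha ((Finset.mem_powersetCard.1 hB).1 h)
    rw [← Finset.erase_insert h1, ← Finset.erase_insert h2, h]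
  · rw [Finset.disjoint_left]
    intro A hA hB
    obtain ⟨B, _, rfl⟩ := Finset.mem_image.1 hB
    exact ha ((Finset.mem_powersetCard.1 hA).1 (Finset.mem_insert_self a B))

/-- elementary symmetric sum -/
noncomputable def es (s : Finset ℕ) (k : ℕ) (z : ℕ → ℝ) : ℝ :=
  ∑ A ∈ s.powersetCard k, ∏ i ∈ A, z i

lemma es_zero (s : Finset ℕ) (z : ℕ → ℝ) : es s 0 z = 1 := by simp [es]

lemma es_empty (k : ℕ) (z : ℕ → ℝ) : es ∅ (k+1) z = 0 := by
  unfold es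
  rw [Finset.powersetCard_eq_empty.2 (by simp), Finset.sum_empty]

lemma es_insert {a : ℕ} {s : Finset ℕ} (ha : a ∉ s) (k : ℕ) (z : ℕ → ℝ) :
    es (insert a s) (k+1) z = es s (k+1) z + z a * es s k z := by
  unfold es
  rw [sum_powersetCard_insert_aux ha, Finset.mul_sum]
  congr 1
  refine Finset.sum_congr rfl fun A hA => ?_
  rw [Finset.prod_insert]
  exact fun h => ha ((Finset.mem_powersetCard.1 hA).1 h)

lemma es_nonneg (s : Finset ℕ) (k : ℕ) (z : ℕ → ℝ) (hz : ∀ i ∈ s, 0 ≤ z i) : 0 ≤ es s k z := by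
  unfold es
  refine Finset.sum_nonneg fun A hA => Finset.prod_nonneg fun i hi => ?_
  exact hz i ((Finset.mem_powersetCard.1 hA).1 hi)

lemma bern (k : ℕ) (a h : ℝ) (ha : 0 ≤ a) (hh : 0 ≤ a + h) :
    a^(k+1) + (k+1) * a^k * h ≤ (a+h)^(k+1) := by
  induction k with
  | zero => simp
  | succ k ih =>
    have := mul_le_mul_of_nonneg_right ih hh
    have h2 : 0 ≤ (k+1) * a^k * h^2 := by positivity
    push_cast
    calc _ ≤ (a ^ (k + 1) + (↑k + 1) * a ^ k * h) * (a + h) := by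
            have : (a ^ (k + 1) + (↑k + 1) * a ^ k * h) * (a + h) =
              a ^ (k + 1 + 1) + (↑k + 1 + 1) * a ^ (k + 1) * h + (k+1) * a^k * h^2 := by ring
            linarith
      _ ≤ _ := by rw [pow_succ (a+h)]; exact this

/-- Maclaurin -/
lemma maclaurin (z : ℕ → ℝ) (s : Finset ℕ) : (∀ i ∈ s, 0 ≤ z i) → ∀ k : ℕ,
    es s k z * (s.card : ℝ)^k ≤ (s.card.choose k : ℝ) * (∑ i ∈ s, z i)^k := by
  induction s using Finset.induction_on with
  | empty =>
    intro _ k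
    cases k with
    | zero => simp [es_zero]
    | succ k => simp [es_empty]
  | insert a s ha ih =>
    intro hz k
    cases k with
    | zero => simp [es_zero]
    | succ k =>
      have hs : ∀ i ∈ s, 0 ≤ z i := fun i hi => hz i (Finset.mem_insert_of_mem hi)
      have hza := hz a (Finset.mem_insert_self a s)
      rw [es_insert ha, Finset.card_insert_of_notMem ha, Finset.sum_insert ha]
      have i1 := ih hs (k+1)
      have i2 := ih hs k
      set N := s.card with hN
      rcases Nat.eq_zero_or_pos N with h0 | hpos
      · have : s = ∅ := Finset.card_eq_zero.1 (hN ▸ h0)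
        subst this
        rw [h0]
        cases k with
        | zero => simp [es_zero, es_empty]
        | succ k => simp [es_empty, Nat.choose_eq_zero_of_lt]
      have hNr : (0:ℝ) < N := by exact_mod_cast hpos
      set S := ∑ i ∈ s, z i with hS
      have hS0 : 0 ≤ S := Finset.sum_nonneg hs
      clear_value S N
      obtain ⟨A, hA⟩ : ∃ A : ℝ, A = S / N := ⟨_, rfl⟩
      have hSA : S = N * A := by rw [hA]; field_simp
      have hA0 : 0 ≤ A := by rw [hA]; positivity
      rw [hSA] at i1 i2 ⊢
      have j1 : es s (k+1) z ≤ (N.choose (k+1) : ℝ) * A^(k+1) := by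
        rw [mul_pow] at i1
        have : (0:ℝ) < (N:ℝ)^(k+1) := by positivity
        refine le_of_mul_le_mul_right ?_ this
        linarith
      have j2 : es s k z ≤ (N.choose k : ℝ) * A^k := by
        rw [mul_pow] at i2
        have : (0:ℝ) < (N:ℝ)^k := by positivity
        refine le_of_mul_le_mul_right ?_ this
        linarith
      have hC : ((N+1).choose (k+1) : ℝ) * (k+1) = (N+1) * N.choose k := by
        have := Nat.add_one_mul_choose_eq N k
        exact_mod_cast this.symm
      have hP : ((N+1).choose (k+1) : ℝ) = N.choose k + N.choose (k+1) := by
        rw [Nat.choose_succ_succ]; push_cast; ring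
      have hb := bern k A ((z a - A)/(N+1)) hA0 (by
        have : A + (z a - A)/(N+1) = (N * A + z a)/(N+1) := by field_simp; ring
        rw [this]; positivity)
      have e1 : (N+1:ℝ) * (A + (z a - A)/(N+1)) = z a + N * A := by field_simp; ring
      push_cast
      rw [← e1, mul_pow, mul_left_comm, mul_comm _ (((N:ℝ)+1)^(k+1))]
      refine mul_le_mul_of_nonneg_left ?_ (by positivity)
      calc es s (k+1) z + z a * es s k z
          ≤ (N.choose (k+1) : ℝ) * A^(k+1) + z a * ((N.choose k : ℝ) * A^k) := by gcongr
        _ = ((N+1).choose (k+1) : ℝ) * (A^(k+1) + (k+1) * A^k * ((z a - A)/(N+1))) := by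
            have : ((N+1).choose (k+1) : ℝ) * (A^(k+1) + (k+1) * A^k * ((z a - A)/(N+1)))
              = ((N+1).choose (k+1) : ℝ) * A^(k+1) + (((N+1).choose (k+1) : ℝ) * (k+1)) * A^k * ((z a - A)/(N+1)) := by ring
            rw [this, hC, hP]; field_simp; ring
        _ ≤ _ := by gcongr

lemma es_le_one (d : ℕ → ℝ) (s : Finset ℕ) (h : ∀ i ∈ s, 0 ≤ d i ∧ d i ≤ 1) (k : ℕ) :
    ((s.card.choose (k+1) : ℝ) - ((s.card-1).choose k : ℝ) * ∑ i ∈ s, d i) ≤ es s (k+1) (fun i => 1 - d i) := by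
  induction s using Finset.induction_on generalizing k with
  | empty => simp [es_empty]
  | insert a s ha ih =>
    have hs : ∀ i ∈ s, 0 ≤ d i ∧ d i ≤ 1 := fun i hi => h i (Finset.mem_insert_of_mem hi)
    obtain ⟨d0, d1⟩ := h a (Finset.mem_insert_self a s)
    rw [es_insert ha, Finset.card_insert_of_notMem ha, Finset.sum_insert ha]
    have i1 := ih hs k
    have hmac : es s k (fun i => 1 - d i) ≤ (s.card.choose k : ℝ) := by
      unfold es
      calc _ ≤ ∑ A ∈ s.powersetCard k, (1:ℝ) := by
            refine Finset.sum_le_sum fun A hA => Finset.prod_le_one ?_ ?_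
            · intro i hi
              have := hs i ((Finset.mem_powersetCard.1 hA).1 hi); linarith
            · intro i hi
              have := hs i ((Finset.mem_powersetCard.1 hA).1 hi); linarith
        _ = _ := by simp
    have hP : ((s.card+1).choose (k+1) : ℝ) = s.card.choose k + s.card.choose (k+1) := by
      rw [Nat.choose_succ_succ]; push_cast; ring
    rw [hP]
    simp only [Nat.add_sub_cancel]
    have hd := mul_le_mul_of_nonneg_left hmac d0
    cases k with
    | zero => simp [es_zero] at *; linarith
    | succ j =>
      have i2 := ih hs j
      have hT : ((s.card - 1).choose (j+1) : ℝ) * ∑ i ∈ s, d i + ((s.card - 1).choose j : ℝ) * ∑ i ∈ s, d i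
          = (s.card.choose (j+1) : ℝ) * ∑ i ∈ s, d i := by
        rcases Nat.eq_zero_or_pos s.card with h0 | hpos
        · have : s = ∅ := Finset.card_eq_zero.1 h0
          subst this; simp
        · obtain ⟨n, hn⟩ := Nat.exists_eq_add_of_lt hpos
          rw [hn]; simp only [zero_add, Nat.add_sub_cancel]
          rw [Nat.choose_succ_succ]; push_cast; ring
      linarith

lemma bonf (d : ℕ → ℝ) (s : Finset ℕ) (h : ∀ i ∈ s, 0 ≤ d i ∧ d i ≤ 1) (k : ℕ) :
    es s (k+2) (fun i => 1 - d i) ≤ (s.card.choose (k+2) : ℝ) - ((s.card-1).choose (k+1) : ℝ) * ∑ i ∈ s, d i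
      + ((s.card-2).choose k : ℝ) * (((∑ i ∈ s, d i)^2 - ∑ i ∈ s, d i^2)/2) := by
  induction s using Finset.induction_on generalizing k with
  | empty => simp [es_empty]
  | insert a s ha ih =>
    have hs : ∀ i ∈ s, 0 ≤ d i ∧ d i ≤ 1 := fun i hi => h i (Finset.mem_insert_of_mem hi)
    obtain ⟨d0, d1⟩ := h a (Finset.mem_insert_self a s)
    rw [es_insert ha, Finset.card_insert_of_notMem ha, Finset.sum_insert ha, Finset.sum_insert ha]
    have i1 := ih hs k
    have hlow := mul_le_mul_of_nonneg_left (es_le_one d s hs k) d0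
    have hP : ((s.card+1).choose (k+2) : ℝ) = s.card.choose (k+1) + s.card.choose (k+2) := by
      rw [Nat.choose_succ_succ]; push_cast; ring
    rw [hP]
    have e1 : s.card + 1 - 2 = s.card - 1 := by omega
    rw [e1]
    simp only [Nat.add_sub_cancel]
    obtain ⟨T, hT⟩ : ∃ T, T = ∑ i ∈ s, d i := ⟨_, rfl⟩
    obtain ⟨P, hPP⟩ : ∃ P, P = ((∑ i ∈ s, d i)^2 - ∑ i ∈ s, d i^2)/2 := ⟨_, rfl⟩
    have e2 : ((d a + ∑ i ∈ s, d i)^2 - (d a ^2 + ∑ i ∈ s, d i^2))/2 = P + d a * T := by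
      rw [hPP, hT]; ring
    rw [e2]
    have hT1 : ((s.card - 1).choose (k+1) : ℝ) * T + ((s.card - 1).choose k : ℝ) * T
          = (s.card.choose (k+1) : ℝ) * T := by
      rcases Nat.eq_zero_or_pos s.card with h0 | hpos
      · have : s = ∅ := Finset.card_eq_zero.1 h0
        subst this; simp [hT]
      · obtain ⟨n, hn⟩ := Nat.exists_eq_add_of_lt hpos
        rw [hn]; simp only [zero_add, Nat.add_sub_cancel]
        rw [Nat.choose_succ_succ]; push_cast; ring
    rw [← hPP, ← hT] at i1
    rw [← hT] at hlow ⊢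
    cases k with
    | zero =>
      have es1 : es s 1 (fun i => 1 - d i) = s.card - T := by
        simp [es, Finset.powersetCard_one, hT]
      simp only [zero_add] at *
      rw [es1]
      simp only [Nat.choose_one_right, Nat.choose_zero_right, Nat.cast_one] at *
      linarith
    | succ j =>
      have i2 := ih hs j
      rw [← hPP, ← hT] at i2
      have hP2 : ((s.card - 2).choose (j+1) : ℝ) * P + ((s.card - 2).choose j : ℝ) * P
          = ((s.card-1).choose (j+1) : ℝ) * P := by
        rcases Nat.lt_or_ge s.card 2 with h0 | hpos
        · have hP0 : P = 0 := by
            rcases Nat.eq_zero_or_pos s.card with h0 | hpos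
            · have : s = ∅ := Finset.card_eq_zero.1 h0
              subst this; simp [hPP]
            · obtain ⟨x, hx⟩ := Finset.card_eq_one.1 (show s.card = 1 by omega)
              subst hx; simp [hPP]
          simp [hP0]
        · obtain ⟨n, hn⟩ := Nat.exists_eq_add_of_le hpos
          rw [hn]; 
          have : 2 + n - 1 = n + 1 := by omega
          rw [this]
          have : 2 + n - 2 = n := by omega
          rw [this]
          rw [Nat.choose_succ_succ]; push_cast; ring
      linarith

lemma pow_lower (k : ℕ) (x : ℝ) (h0 : 0 ≤ x) (h1 : x ≤ 1) :
    (1 - k * x ≤ (1-x)^k ∧ (1-x)^k ≤ 1 - k * x + k*(k-1)/2*x^2) ∧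
    1 - k * x + k*(k-1)/2*x^2 - k*(k-1)*(k-2)/6*x^3 ≤ (1-x)^k := by
  induction k with
  | zero => simp
  | succ k ih =>
    obtain ⟨⟨a, b⟩, c⟩ := ih
    rw [pow_succ]
    have e : (1-x)^k * (1-x) = (1-x)^k - x * (1-x)^k := by ring
    rw [e]
    have hone : (1-x)^k ≤ 1 := pow_le_one₀ (by linarith) (by linarith)
    have a' := mul_le_mul_of_nonneg_left a h0
    have b' := mul_le_mul_of_nonneg_left b h0
    have hone' := mul_le_mul_of_nonneg_left hone h0
    push_cast
    refine ⟨⟨?_, ?_⟩, ?_⟩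
    · linarith
    · have : 1 - ((k:ℝ)+1) * x + (k+1)*(k+1-1)/2*x^2 = (1 - k * x + k*(k-1)/2*x^2) - x * (1 - k * x) := by ring
      rw [this]; linarith
    · have : 1 - ((k:ℝ)+1) * x + (k+1)*(k+1-1)/2*x^2 - (k+1)*(k+1-1)*(k+1-2)/6*x^3 = (1 - k * x + k*(k-1)/2*x^2 - k*(k-1)*(k-2)/6*x^3) - x * (1 - k * x + k*(k-1)/2*x^2) := by ring
      rw [this]; linarith

lemma exp_poly (j : ℕ) : ((j:ℝ)+5)^3*(j+4) + 3 * (j+5)^2*(j+7) + 6 ≤ 6 * ((j+6) * 2^(j+5)) := by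
  induction j with
  | zero => norm_num
  | succ j ih =>
    have hj : (0:ℝ) ≤ j := Nat.cast_nonneg j
    have h2 : (0:ℝ) < 2^(j+5) := by positivity
    have e : (2:ℝ)^(j+1+5) = 2 * 2^(j+5) := by ring
    rw [e]; push_cast
    have : ((j:ℝ)+1+5)^3*(j+1+4) + 3 * (j+1+5)^2*(j+1+7) + 6 ≤ 2 * (((j:ℝ)+5)^3*(j+4) + 3 * (j+5)^2*(j+7) + 6) := by
      rw [← sub_nonneg]
      have : 0 ≤ (j:ℝ)^4 + 18 * j^3 + 110 * j^2 + 200 * j := by positivity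
      ring_nf
      nlinarith [pow_nonneg hj 2, pow_nonneg hj 3, pow_nonneg hj 4]
    nlinarith

lemma num_ineq (k K : ℕ) (hk : 3 ≤ k) (hK : k * 2^(k-1) ≤ K + 1) :
    0 ≤ (K:ℝ) * (K - (k-1)^3*(k-2)/6 - (k-1)^2/2*(k+1)) + k * (K - (k-1)^2/2*k) := by
  rcases Nat.lt_or_ge k 6 with h | h
  · interval_cases k
    · have : (11:ℝ) ≤ K := by norm_num at hK; exact_mod_cast (by omega : 11 ≤ K)
      norm_num; nlinarith
    · have : (31:ℝ) ≤ K := by norm_num at hK; exact_mod_cast (by omega : 31 ≤ K)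
      norm_num; nlinarith
    · have : (79:ℝ) ≤ K := by norm_num at hK; exact_mod_cast (by omega : 79 ≤ K)
      norm_num; nlinarith
  · obtain ⟨j, rfl⟩ := Nat.exists_eq_add_of_le' h
    have e := exp_poly j
    have hK' : ((j:ℝ)+6) * 2^(j+5) ≤ K + 1 := by
      have : j + 6 - 1 = j + 5 := by omega
      rw [this] at hK
      exact_mod_cast hK
    have hj : (0:ℝ) ≤ j := Nat.cast_nonneg j
    push_cast
    have hmain : ((j:ℝ)+5)^3*(j+4)/6 + (j+5)^2/2*(j+7) ≤ K := by linarith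
    have h1 : 0 ≤ (K:ℝ) * (K - (j+6-1)^3*(j+6-2)/6 - (j+6-1)^2/2*(j+6+1)) := by
      apply mul_nonneg (Nat.cast_nonneg _)
      have : ((j:ℝ)+5)^3*(j+4)/6 + (j+5)^2/2*(j+7) = (j+6-1)^3*(j+6-2)/6 + (j+6-1)^2/2*(j+6+1) := by ring
      linarith
    have h2 : 0 ≤ ((j:ℝ)+6) * (K - (j+6-1)^2/2*(j+6)) := by
      apply mul_nonneg (by positivity)
      have p1 : 0 ≤ ((j:ℝ)+5)^3*(j+4)/6 := by positivity
      have p2 : 0 ≤ ((j:ℝ)+5)^2/2 := by positivity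
      have : ((j:ℝ)+6-1)^2/2*(j+6) = (j+5)^2/2*(j+7) - (j+5)^2/2 := by ring
      linarith
    linarith

lemma frac_ineq (k K : ℕ) (hk : 3 ≤ k) (hK : k * 2^(k-1) ≤ K + 1) (N s : ℝ) (hN : N = k + K)
    (hs0 : 0 ≤ s) (hs : s ≤ k - 1) :
    1 - k * (s+1) / N + k * (k-1) / (N * (N-1)) * (((s+1)^2-1)/2) ≤
      (1 - k/N) * (1 - k * (s/N) + k*(k-1)/2*(s/N)^2 - k*(k-1)*(k-2)/6*(s/N)^3) := by
  have hn := num_ineq k K hk hK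
  have hk' : (3:ℝ) ≤ k := by exact_mod_cast hk
  have hK0 : (0:ℝ) ≤ K := Nat.cast_nonneg _
  have hNpos : 0 < N := by linarith
  have hN1 : 0 < N - 1 := by linarith
  have hKN : (K:ℝ) = N - k := by linarith
  have key : 0 ≤ N*(N-k) - (k-1)*s/2*(k*(N-1)+N) - (N-k)*(k-1)*(k-2)*s^2/6 * ((N-1)/N) := by
    have t1 : (k-1)*s/2*(k*(N-1)+N) ≤ ((k:ℝ)-1)*(k-1)/2*(k*(N-1)+N) := by
      gcongr
      linarith
    have t2 : (N-k)*(k-1)*(k-2)*s^2/6 * ((N-1)/N) ≤ (N-k)*((k:ℝ)-1)*(k-2)*(k-1)^2/6 * 1 := by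
      have : 0 ≤ N - k := by linarith
      have : (0:ℝ) ≤ k - 1 := by linarith
      have : (0:ℝ) ≤ k - 2 := by linarith
      have : (N-1)/N ≤ 1 := by rw [div_le_one hNpos]; linarith
      have : 0 ≤ (N-1)/N := by positivity
      gcongr
    have : 0 ≤ N*(N-k) - ((k:ℝ)-1)*(k-1)/2*(k*(N-1)+N) - (N-k)*((k:ℝ)-1)*(k-2)*(k-1)^2/6 * 1 := by
      rw [hN]
      refine hn.trans_eq ?_
      ring
    linarith
  rw [← sub_nonneg]
  have : (1 - k/N) * (1 - k * (s/N) + k*(k-1)/2*(s/N)^2 - k*(k-1)*(k-2)/6*(s/N)^3) - (1 - k * (s+1) / N + k * (k-1) / (N * (N-1)) * (((s+1)^2-1)/2)) = k * s / (N^3*(N-1)) * (N*(N-k) - (k-1)*s/2*(k*(N-1)+N) - (N-k)*(k-1)*(k-2)*s^2/6 * ((N-1)/N)) := by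
    field_simp
    ring
  rw [this]
  exact mul_nonneg (by positivity) key

lemma low_case (U : Finset ℕ) (w : ℕ → ℝ) (M : ℝ) (k K : ℕ) (hk : 2 ≤ k)
    (hK : k * 2^(k-1) ≤ K + 1) (hU : U.card = k + K) (hM : 0 < M)
    (hw0 : ∀ i ∈ U, 0 ≤ w i) (hw1 : ∀ i ∈ U, w i ≤ M) (hsum : ∑ i ∈ U, w i = 1 - M)
    (L : Finset ℕ) (hL : L ⊆ U) (hL4 : L.card = 4) (hLw : ∀ i ∈ L, 2 * w i ≤ M) :
    es U k w * (U.card : ℝ)^k ≤ ((U.card - 1).choose k : ℝ) := by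
  obtain ⟨d, hd⟩ : ∃ d : ℕ → ℝ, d = fun i => 1 - w i / M := ⟨_, rfl⟩
  have hwd : ∀ i, w i = M * (1 - d i) := by intro i; rw [hd]; field_simp; ring
  have hd01 : ∀ i ∈ U, 0 ≤ d i ∧ d i ≤ 1 := by
    intro i hi
    rw [hd]
    have h1 : w i / M ≤ 1 := (div_le_one hM).2 (hw1 i hi)
    have h2 : 0 ≤ w i / M := div_nonneg (hw0 i hi) hM.le
    constructor <;> simp only <;> linarith
  have hdL : ∀ i ∈ L, 1/2 ≤ d i := by
    intro i hi
    rw [hd]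
    have h1 : w i / M ≤ 1/2 := by rw [div_le_iff₀ hM]; linarith [hLw i hi]
    simp only; linarith
  obtain ⟨T, hT⟩ : ∃ T, T = ∑ i ∈ U, d i := ⟨_, rfl⟩
  have hT2 : 2 ≤ T := by
    rw [hT]
    calc (2:ℝ) = ∑ i ∈ L, (1/2:ℝ) := by rw [Finset.sum_const, hL4]; norm_num
      _ ≤ ∑ i ∈ L, d i := Finset.sum_le_sum hdL
      _ ≤ _ := Finset.sum_le_sum_of_subset_of_nonneg hL fun i hi _ => (hd01 i hi).1
  have hQ : 1 ≤ ∑ i ∈ U, d i^2 := by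
    calc (1:ℝ) = ∑ i ∈ L, (1/4:ℝ) := by rw [Finset.sum_const, hL4]; norm_num
      _ ≤ ∑ i ∈ L, d i^2 := Finset.sum_le_sum fun i hi => by nlinarith [hdL i hi]
      _ ≤ _ := Finset.sum_le_sum_of_subset_of_nonneg hL fun i hi _ => sq_nonneg _
  obtain ⟨N, hN⟩ : ∃ N, N = U.card := ⟨_, rfl⟩
  rw [← hN]
  have hsumd : M * ((N:ℝ) - T) = 1 - M := by
    rw [← hsum, hN, hT, Finset.card_eq_sum_ones]
    push_cast
    rw [← Finset.sum_sub_distrib, Finset.mul_sum]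
    exact Finset.sum_congr rfl fun i _ => (hwd i).symm
  have hMN : M * ((N:ℝ) + 1 - T) = 1 := by linarith
  have hNk : N = k + K := hN.trans hU
  have hKpos : 1 ≤ K := by
    have : 2 * 2^1 ≤ k * 2^(k-1) := Nat.mul_le_mul hk (Nat.pow_le_pow_right (by norm_num) (by omega))
    omega
  have hNr : (N:ℝ) = k + K := by rw [hNk]; push_cast; rfl
  have hKr : (1:ℝ) ≤ K := by exact_mod_cast hKpos
  have hkr : (2:ℝ) ≤ k := by exact_mod_cast hk
  have hNpos : (0:ℝ) < N := by linarith
  -- C(N-1,k) * N = C(N,k) * (N-k)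
  have hC1 : ((N-1).choose k : ℝ) = (N.choose k : ℝ) * (1 - k/N) := by
    obtain ⟨n, hn⟩ : ∃ n, N = n + 1 := ⟨N - 1, by omega⟩
    have := Nat.choose_mul_succ_eq n k
    have h3 : n + 1 - k = K := by omega
    rw [h3] at this
    have h4 : (n.choose k : ℝ) * (n+1) = ((n+1).choose k : ℝ) * K := by exact_mod_cast this
    have h5 : (K:ℝ) = N - k := by linarith
    rw [hn, Nat.add_sub_cancel]
    have h6 : (N:ℝ) = n + 1 := by rw [hn]; push_cast; rfl
    push_cast
    rw [← h6] at h4 ⊢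
    rw [h5] at h4
    field_simp
    linarith
  rcases le_or_gt (k:ℝ) T with hTk | hTk
  · have hmac := maclaurin w U hw0 k
    rw [← hN, hsum] at hmac
    refine hmac.trans ?_
    rw [hC1]
    refine mul_le_mul_of_nonneg_left ?_ (by positivity)
    have hM1 : 0 ≤ 1 - M := by rw [← hsum]; exact Finset.sum_nonneg hw0
    have hKM : 1 ≤ M * (K + 1) := by nlinarith
    have h1 : 1 - M ≤ K/(K+1) := by
      rw [le_div_iff₀ (by positivity)]; linarith
    have h2 : (1 - M)^k ≤ ((K:ℝ)/(K+1))^k := by gcongr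
    refine h2.trans ?_
    have h0K : 0 ≤ 1/(K:ℝ) := by positivity
    have h3 := one_add_mul_le_pow (a := 1/(K:ℝ)) (by linarith) k
    have h4 : (1:ℝ) - k/N = 1/(1 + k * (1/K)) := by rw [hNr]; field_simp; ring
    have h5 : ((K:ℝ)/(K+1)) = 1/(1 + 1/K) := by field_simp
    rw [h4, h5, div_pow, one_pow]
    apply one_div_le_one_div_of_le _ h3
    positivity
  · have hk3 : 3 ≤ k := by
      have : (2:ℝ) < k := by linarith
      have : 2 < k := by exact_mod_cast this
      omega
    obtain ⟨j, hj⟩ : ∃ j, k = j + 2 := ⟨k - 2, by omega⟩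
    have hb := bonf d U hd01 j
    rw [← hN, ← hT] at hb
    have hes : es U k w = M^k * es U k (fun i => 1 - d i) := by
      unfold es
      rw [Finset.mul_sum]
      refine Finset.sum_congr rfl fun A hA => ?_
      rw [← (Finset.mem_powersetCard.1 hA).2, ← Finset.prod_const, ← Finset.prod_mul_distrib]
      exact Finset.prod_congr rfl fun i _ => hwd i
    have hN1 : (0:ℝ) < N - 1 := by linarith
    have hC2 : ((N-1).choose (j+1) : ℝ) = (N.choose k : ℝ) * (k / N) := by
      obtain ⟨n, hn⟩ : ∃ n, N = n + 1 := ⟨N - 1, by omega⟩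
      have := Nat.add_one_mul_choose_eq n (j+1)
      have h4 : ((n:ℝ)+1) * n.choose (j+1) = (n+1).choose (j+2) * (j+2) := by exact_mod_cast this
      have h6 : (N:ℝ) = n + 1 := by rw [hn]; push_cast; rfl
      have h7 : (k:ℝ) = j + 2 := by rw [hj]; push_cast; rfl
      rw [h6, h7, hn, hj, Nat.add_sub_cancel]
      field_simp
      linarith
    have hC3 : ((N-2).choose j : ℝ) = (N.choose k : ℝ) * (k * (k-1) / (N * (N-1))) := by
      obtain ⟨n, hn⟩ : ∃ n, N = n + 2 := ⟨N - 2, by omega⟩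
      have := Nat.add_one_mul_choose_eq n j
      have h4 : ((n:ℝ)+1) * n.choose j = (n+1).choose (j+1) * (j+1) := by exact_mod_cast this
      have h6 : (N:ℝ) = n + 2 := by rw [hn]; push_cast; rfl
      have h7 : (k:ℝ) = j + 2 := by rw [hj]; push_cast; rfl
      have h8 : (N:ℝ) - 1 = n + 1 := by rw [h6]; ring
      have e1 : N - 2 = n := by omega
      have e2 : N - 1 = n + 1 := by omega
      rw [e2] at hC2
      rw [hC2] at h4
      rw [e1]
      have : (n.choose j : ℝ) = (N.choose k * (k/N)) * (j+1) / (n+1) := by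
        field_simp
        field_simp at h4
        linarith
      rw [this, h8, h7]
      field_simp
      ring
    rw [← hj, hC2, hC3] at hb
    have hP : ((T^2 - ∑ i ∈ U, d i^2)/2) ≤ (((T-1)+1)^2-1)/2 := by
      have : (T-1+1) = T := by ring
      rw [this]; linarith
    have hf := frac_ineq k K hk3 hK N (T-1) hNr (by linarith) (by linarith)
    have hx0 : 0 ≤ (T-1)/N := div_nonneg (by linarith) hNpos.le
    have hx1 : (T-1)/N ≤ 1 := by rw [div_le_one hNpos]; linarith
    have hpl := (pow_lower k ((T-1)/N) hx0 hx1).2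
    have hkN : 0 ≤ 1 - (k:ℝ)/N := by
      have : (k:ℝ)/N ≤ 1 := by rw [div_le_one hNpos]; linarith
      linarith
    have hb2 : es U k (fun i => 1 - d i) ≤ N.choose k * ((1 - k/N) * (1 - (T-1)/N)^k) := by
      refine hb.trans ?_
      have hcoef : 0 ≤ (k:ℝ) * (k-1) / (N * (N-1)) := by
        apply div_nonneg <;> apply mul_nonneg <;> linarith
      have h1 := mul_le_mul_of_nonneg_left hP hcoef
      have h2 := mul_le_mul_of_nonneg_left hpl hkN
      have h3 : 1 - k * T / N + k * (k-1) / (N * (N-1)) * ((T^2 - ∑ i ∈ U, d i^2)/2) ≤ (1 - k/N) * (1 - (T-1)/N)^k := by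
        have : k * (T - 1 + 1) / N = k * T / (N:ℝ) := by ring
        rw [this] at hf
        linarith
      refine le_trans (le_of_eq ?_) (mul_le_mul_of_nonneg_left h3 (Nat.cast_nonneg (N.choose k)))
      ring
    rw [hes, hC1]
    calc M^k * es U k (fun i => 1 - d i) * (N:ℝ)^k ≤ M^k * (N.choose k * ((1 - k/N) * (1 - (T-1)/N)^k)) * (N:ℝ)^k := by gcongr
      _ = N.choose k * (1 - k/N) * (M * ((1 - (T-1)/N) * N))^k := by rw [mul_pow, mul_pow]; ring
      _ = N.choose k * (1 - k/N) := by
        have : M * ((1 - (T-1)/N) * N) = 1 := by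
          have h9 : M * ((1 - (T-1)/N) * N) = M * ((N:ℝ) + 1 - T) := by field_simp; ring
          rw [h9, hMN]
        rw [this, one_pow, mul_one]

lemma merge_case (V : Finset ℕ) (E : Finset (Finset ℕ)) (w : ℕ → ℝ) (n q : ℕ) (M : ℝ) (a b c : ℕ)
    (hV : V.card = n + 2) (hE : E ⊆ V.powersetCard (q+2)) (hw0 : ∀ i ∈ V, 0 ≤ w i)
    (hsum : ∑ i ∈ V, w i = 1) (hwM : ∀ i ∈ V, w i ≤ M) (ha : a ∈ V) (hb : b ∈ V) (hab : a ≠ b)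
    (hbmin : ∀ i ∈ V, w b ≤ w i) (hamin : ∀ i ∈ V, i ≠ b → w a ≤ w i)
    (hhalf : ∀ i ∈ V, i ≠ a → i ≠ b → i ≠ c → M / 2 ≤ w i)
    (hm : (E.card : ℝ) ≤ ((n+1).choose (q+2) : ℝ) + (n.choose (q+1) : ℝ) -
      (2:ℝ)^q * ((n.choose q : ℝ) - 1)) (hC : (2:ℝ)^q ≤ n.choose q) :
    lagPoly E w * ((n:ℝ)+1)^(q+2) ≤ ((n+1).choose (q+2) : ℝ) := by
  obtain ⟨S, hS⟩ : ∃ S, S = (V.erase a).erase b := ⟨_, rfl⟩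
  have hbS : b ∉ S := by rw [hS]; simp
  have haS : a ∉ S := by rw [hS]; simp
  have haS' : a ∉ insert b S := by simp [hab, haS]
  have hVS : V = insert a (insert b S) := by
    rw [hS, Finset.insert_erase (by simp [hb, hab.symm]), Finset.insert_erase ha]
  have hSc : S.card = n := by
    rw [hVS, Finset.card_insert_of_notMem haS', Finset.card_insert_of_notMem hbS] at hV
    omega
  have hM0 : 0 ≤ M := (hw0 a ha).trans (hwM a ha)
  have hwa := hw0 a ha
  have hwb := hw0 b hb
  obtain ⟨c0, hc0⟩ : ∃ c0, c0 = w a * w b * (M/2)^q := ⟨_, rfl⟩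
  have hc0n : 0 ≤ c0 := by rw [hc0]; positivity
  have h2q : (1:ℝ) ≤ 2^q := one_le_pow₀ (by norm_num)
  obtain ⟨g, hg⟩ : ∃ g : Finset ℕ → ℝ, g = fun A => if a ∈ A ∧ b ∈ A then c0 * (2^q - 1)
      else ∏ i ∈ A, w i - c0 := ⟨_, rfl⟩
  have hpt : ∀ A ∈ V.powersetCard (q+2), (if A ∈ E then ∏ i ∈ A, w i else 0) ≤
      g A + c0 * (if A ∈ E then 1 else 0) := by
    intro A hA
    obtain ⟨hAV, hAc⟩ := Finset.mem_powersetCard.1 hA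
    by_cases hboth : a ∈ A ∧ b ∈ A
    · have hgA : g A = c0 * (2^q - 1) := by rw [hg]; simp [hboth]
      rw [hgA]
      split_ifs with hAE
      · have e : A = insert a (insert b ((A.erase a).erase b)) := by
          rw [Finset.insert_erase (by simp [hboth.2, hab.symm]), Finset.insert_erase hboth.1]
        have hcard : ((A.erase a).erase b).card = q := by
          rw [Finset.card_erase_of_mem (by simp [hboth.2, hab.symm]), Finset.card_erase_of_mem hboth.1]
          omega
        rw [e, Finset.prod_insert (by simp [hab]), Finset.prod_insert (by simp)]
        have : ∏ i ∈ (A.erase a).erase b, w i ≤ M^q := by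
          rw [← hcard, ← Finset.prod_const]
          apply Finset.prod_le_prod
          · intro i hi
            exact hw0 i (hAV (Finset.mem_of_mem_erase (Finset.mem_of_mem_erase hi)))
          · intro i hi
            exact hwM i (hAV (Finset.mem_of_mem_erase (Finset.mem_of_mem_erase hi)))
        have e2 : c0 * (2^q-1) + c0 * 1 = w a * (w b * M^q) := by
          rw [hc0, div_pow]; field_simp; ring
        rw [e2]
        gcongr
      · have := mul_nonneg hc0n (sub_nonneg.2 h2q)
        linarith
    · have hgA : g A = ∏ i ∈ A, w i - c0 := by rw [hg]; simp only [if_neg hboth]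
      rw [hgA]
      split_ifs with hAE
      · linarith
      · suffices c0 ≤ ∏ i ∈ A, w i by linarith
        have hcard : q ≤ (A \ {a, b, c}).card := by
          have h1 : (A ∩ {a,b,c}).card ≤ 2 := by
            rw [not_and_or] at hboth
            rcases hboth with h | h
            · have : A ∩ {a,b,c} ⊆ {b, c} := by
                intro x hx
                simp only [Finset.mem_inter, Finset.mem_insert, Finset.mem_singleton] at hx ⊢
                rcases hx with ⟨h1, rfl | h2 | h2⟩
                · exact absurd h1 h
                · exact Or.inl h2
                · exact Or.inr h2
              exact (Finset.card_le_card this).trans Finset.card_le_two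
            · have : A ∩ {a,b,c} ⊆ {a, c} := by
                intro x hx
                simp only [Finset.mem_inter, Finset.mem_insert, Finset.mem_singleton] at hx ⊢
                rcases hx with ⟨h1, h2 | rfl | h2⟩
                · exact Or.inl h2
                · exact absurd h1 h
                · exact Or.inr h2
              exact (Finset.card_le_card this).trans Finset.card_le_two
          have := Finset.card_sdiff_add_card_inter A {a,b,c}
          omega
        obtain ⟨B, hBs, hBc⟩ := Finset.exists_subset_card_eq hcard
        have hBA : B ⊆ A := hBs.trans Finset.sdiff_subset
        have h2 : (A \ B).card = 2 := by
          rw [Finset.card_sdiff_of_subset hBA]; omega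
        obtain ⟨i, j, hij, hAB⟩ := Finset.card_eq_two.1 h2
        have hiV : i ∈ V := hAV (Finset.sdiff_subset (hAB ▸ (by simp : i ∈ ({i,j} : Finset ℕ))))
        have hjV : j ∈ V := hAV (Finset.sdiff_subset (hAB ▸ (by simp : j ∈ ({i,j} : Finset ℕ))))
        rw [← Finset.prod_sdiff hBA, hAB, Finset.prod_pair hij, hc0]
        have hp1 : (M/2)^q ≤ ∏ i ∈ B, w i := by
          rw [← hBc, ← Finset.prod_const]
          apply Finset.prod_le_prod
          · intros; positivity
          · intro x hx
            have := hBs hx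
            simp only [Finset.mem_sdiff, Finset.mem_insert, Finset.mem_singleton, not_or] at this
            exact hhalf x (hAV this.1) this.2.1 this.2.2.1 this.2.2.2
        have hp2 : w a * w b ≤ w i * w j := by
          by_cases hib : i = b
          · have hjb : j ≠ b := fun h => hij (hib.trans h.symm)
            have := hamin j hjV hjb
            rw [hib, mul_comm (w b)]; gcongr
          · have := hamin i hiV hib
            have := hbmin j hjV
            have := hw0 i hiV
            gcongr
        have := hw0 i hiV
        have := hw0 j hjV
        gcongr
  have hlag : lagPoly E w = ∑ A ∈ V.powersetCard (q+2), (if A ∈ E then ∏ i ∈ A, w i else 0) := by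
    unfold lagPoly
    rw [Finset.sum_ite_mem, Finset.inter_eq_right.2 hE]
  have hcardE : ∑ A ∈ V.powersetCard (q+2), (if A ∈ E then (1:ℝ) else 0) = E.card := by
    rw [Finset.sum_ite_mem, Finset.inter_eq_right.2 hE]; simp
  have hgsum : ∑ A ∈ V.powersetCard (q+2), g A =
      (es S (q+2) w - c0 * n.choose (q+2)) + (w b * es S (q+1) w - c0 * n.choose (q+1)) +
      ((w a * es S (q+1) w - c0 * n.choose (q+1)) + c0 * (2^q-1) * n.choose q) := by
    rw [hVS, sum_powersetCard_insert_aux haS', sum_powersetCard_insert_aux hbS,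
      sum_powersetCard_insert_aux hbS]
    have hsub : ∀ k, ∀ A ∈ S.powersetCard k, a ∉ A ∧ b ∉ A := by
      intro k A hA
      have := (Finset.mem_powersetCard.1 hA).1
      exact ⟨fun h => haS (this h), fun h => hbS (this h)⟩
    congr 1
    · congr 1
      · rw [Finset.sum_congr rfl (g := fun A => ∏ i ∈ A, w i - c0)]
        · rw [Finset.sum_sub_distrib]; simp [es, hSc, mul_comm]
        · intro A hA
          rw [hg]; simp [hsub _ A hA]
      · rw [Finset.sum_congr rfl (g := fun A => w b * ∏ i ∈ A, w i - c0)]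
        · rw [Finset.sum_sub_distrib, ← Finset.mul_sum]; simp [es, hSc, mul_comm]
        · intro A hA
          rw [hg]; simp [hsub _ A hA, hab]
    · congr 1
      · rw [Finset.sum_congr rfl (g := fun A => w a * ∏ i ∈ A, w i - c0)]
        · rw [Finset.sum_sub_distrib, ← Finset.mul_sum]; simp [es, hSc, mul_comm]
        · intro A hA
          rw [hg]; simp [hsub _ A hA, hab.symm]
      · rw [Finset.sum_congr rfl (g := fun A => c0 * (2^q-1))]
        · simp [hSc, mul_comm]
        · intro A hA
          rw [hg]; simp
  have htot : lagPoly E w ≤ es S (q+2) w + (w a + w b) * es S (q+1) w := by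
    have h1 : lagPoly E w ≤ ∑ A ∈ V.powersetCard (q+2), g A + c0 * E.card := by
      rw [hlag, ← hcardE, Finset.mul_sum, ← Finset.sum_add_distrib]
      exact Finset.sum_le_sum hpt
    rw [hgsum] at h1
    have hP : ((n+1).choose (q+2) : ℝ) = n.choose (q+1) + n.choose (q+2) := by
      rw [Nat.choose_succ_succ]; push_cast; ring
    rw [hP] at hm
    have h2 := mul_le_mul_of_nonneg_left hm hc0n
    have h3 := mul_le_mul_of_nonneg_left hC hc0n
    linarith
  have hmac := maclaurin (Function.update w a (w a + w b)) (insert a S) (by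
    intro i hi
    by_cases hia : i = a
    · subst hia; simp; positivity
    · rw [Function.update_of_ne hia]
      apply hw0
      rw [hVS]
      rcases Finset.mem_insert.1 hi with h | h
      · exact absurd h hia
      · simp [h]) (q+2)
  have hup : ∀ i ∈ S, Function.update w a (w a + w b) i = w i := by
    intro i hi
    rw [Function.update_of_ne]
    rintro rfl; exact haS hi
  have hesup : ∀ k, es S k (Function.update w a (w a + w b)) = es S k w := by
    intro k
    refine Finset.sum_congr rfl fun A hA => Finset.prod_congr rfl fun i hi => ?_
    exact hup i ((Finset.mem_powersetCard.1 hA).1 hi)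
  have hs1 : ∑ i ∈ insert a S, Function.update w a (w a + w b) i = 1 := by
    rw [Finset.sum_insert haS, Finset.sum_congr rfl hup, Function.update_self, ← hsum, hVS,
      Finset.sum_insert haS', Finset.sum_insert hbS]
    ring
  rw [hs1, es_insert haS, hesup, hesup, Finset.card_insert_of_notMem haS, hSc, Function.update_self,
    one_pow, mul_one] at hmac
  push_cast at hmac
  refine le_trans ?_ hmac
  gcongr

lemma exists_opt (E : Finset (Finset ℕ)) (t r : ℕ) (ht : 0 < t) (hr : 0 < r)
    (hE : E ⊆ (Finset.range t).powersetCard r) :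
    ∃ w : ℕ → ℝ, (∀ i, 0 ≤ w i) ∧ ∑ i ∈ Finset.range t, w i = 1 ∧
      ∀ u : ℕ → ℝ, (∀ i, 0 ≤ u i) → lagPoly E u ≤ lagPoly E w * (∑ i ∈ Finset.range t, u i)^r := by
  obtain ⟨K, hK⟩ : ∃ K : Set (ℕ → ℝ), K = (Set.univ.pi fun _ => Set.Icc (0:ℝ) 1) ∩
      {w | ∑ i ∈ Finset.range t, w i = 1} := ⟨_, rfl⟩
  have hKc : IsCompact K := by
    rw [hK]
    apply (isCompact_univ_pi fun _ => isCompact_Icc).inter_right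
    exact isClosed_eq (by fun_prop) continuous_const
  have hKn : K.Nonempty := by
    refine ⟨fun i => if i = 0 then 1 else 0, ?_⟩
    rw [hK]
    refine ⟨?_, ?_⟩
    · intro i _
      simp only
      split_ifs <;> simp
    · simp [ht]
  have hcont : Continuous (lagPoly E) := by
    unfold lagPoly; fun_prop
  obtain ⟨w, hwK, hmax⟩ := hKc.exists_isMaxOn hKn hcont.continuousOn
  rw [hK] at hwK
  have hw0 : ∀ i, 0 ≤ w i := fun i => (hwK.1 i trivial).1
  refine ⟨w, hw0, hwK.2, ?_⟩
  intro u hu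
  obtain ⟨s, hs⟩ : ∃ s, s = ∑ i ∈ Finset.range t, u i := ⟨_, rfl⟩
  rw [← hs]
  have hs0 : 0 ≤ s := by rw [hs]; exact Finset.sum_nonneg fun i _ => hu i
  rcases hs0.eq_or_lt with h0 | hpos
  · have hz : ∀ i ∈ Finset.range t, u i = 0 :=
      (Finset.sum_eq_zero_iff_of_nonneg fun i _ => hu i).1 (hs.symm.trans h0.symm)
    rw [← h0, zero_pow hr.ne', mul_zero]
    apply le_of_eq
    apply Finset.sum_eq_zero
    intro A hA
    obtain ⟨h1, h2⟩ := Finset.mem_powersetCard.1 (hE hA)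
    obtain ⟨i, hi⟩ := Finset.card_pos.1 (h2 ▸ hr)
    exact Finset.prod_eq_zero hi (hz i (h1 hi))
  · obtain ⟨y, hy⟩ : ∃ y : ℕ → ℝ, y = fun i => if i < t then u i / s else 0 := ⟨_, rfl⟩
    have hyt : ∀ i ∈ Finset.range t, y i = u i / s := by
      intro i hi; rw [hy]; simp [Finset.mem_range.1 hi]
    have hyK : y ∈ K := by
      rw [hK]
      constructor
      · intro i _
        rw [hy]; simp only
        split_ifs with h
        · refine ⟨div_nonneg (hu i) hs0, (div_le_one hpos).2 ?_⟩
          rw [hs]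
          exact Finset.single_le_sum (fun i _ => hu i) (Finset.mem_range.2 h)
        · simp
      · show ∑ i ∈ Finset.range t, y i = 1
        rw [Finset.sum_congr rfl hyt, ← Finset.sum_div, ← hs, div_self hpos.ne']
    have h1 : lagPoly E y ≤ lagPoly E w := hmax hyK
    have h2 : lagPoly E u = lagPoly E y * s^r := by
      unfold lagPoly
      rw [Finset.sum_mul]
      refine Finset.sum_congr rfl fun A hA => ?_
      obtain ⟨h1, h2⟩ := Finset.mem_powersetCard.1 (hE hA)
      rw [← h2, ← Finset.prod_const, ← Finset.prod_mul_distrib]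
      refine Finset.prod_congr rfl fun i hi => ?_
      rw [hyt i (h1 hi)]; field_simp
    rw [h2]
    gcongr

lemma grad_bound (E : Finset (Finset ℕ)) (t k v : ℕ) (w : ℕ → ℝ)
    (hE : E ⊆ (Finset.range t).powersetCard (k+1)) (hw0 : ∀ i, 0 ≤ w i)
    (hsum : ∑ i ∈ Finset.range t, w i = 1)
    (hopt : ∀ u : ℕ → ℝ, (∀ i, 0 ≤ u i) →
      lagPoly E u ≤ lagPoly E w * (∑ i ∈ Finset.range t, u i)^(k+1))
    (hv : v ∈ Finset.range t) (hvpos : 0 < w v) :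
    ((k:ℝ)+1) * lagPoly E w ≤ es ((Finset.range t).erase v) k w := by
  obtain ⟨D, hD⟩ : ∃ D, D = ∑ A ∈ E with v ∈ A, ∏ i ∈ A.erase v, w i := ⟨_, rfl⟩
  have hDle : D ≤ es ((Finset.range t).erase v) k w := by
    rw [hD]
    have hinj : Set.InjOn (fun A : Finset ℕ => A.erase v) ((E.filter (v ∈ ·) : Finset (Finset ℕ)) : Set (Finset ℕ)) := by
      intro A hA B hB h
      have h1 := (Finset.mem_filter.1 hA).2
      have h2 := (Finset.mem_filter.1 hB).2
      simp only at h
      rw [← Finset.insert_erase h1, ← Finset.insert_erase h2, h]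
    rw [← Finset.sum_image (f := fun A => ∏ i ∈ A, w i) hinj]
    apply Finset.sum_le_sum_of_subset_of_nonneg
    · intro B hB
      obtain ⟨A, hA, rfl⟩ := Finset.mem_image.1 hB
      obtain ⟨hA1, hA2⟩ := Finset.mem_filter.1 hA
      obtain ⟨h1, h2⟩ := Finset.mem_powersetCard.1 (hE hA1)
      rw [Finset.mem_powersetCard]
      refine ⟨Finset.erase_subset_erase v h1, ?_⟩
      rw [Finset.card_erase_of_mem hA2, h2]; rfl
    · intro A _ _
      exact Finset.prod_nonneg fun i _ => hw0 i
  refine le_trans ?_ hDle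
  obtain ⟨Λ, hΛ⟩ : ∃ Λ, Λ = lagPoly E w := ⟨_, rfl⟩
  rw [← hΛ] at hopt ⊢
  have hΛ0 : 0 ≤ Λ := by
    rw [hΛ]; exact Finset.sum_nonneg fun A _ => Finset.prod_nonneg fun i _ => hw0 i
  have hwv1 : w v ≤ 1 := by
    rw [← hsum]; exact Finset.single_le_sum (fun i _ => hw0 i) hv
  have hstep : ∀ h : ℝ, 0 < h → h ≤ w v → (k+1) * Λ ≤ D + (Λ * ((k+1)*k/2)) * h := by
    intro h h0 h1
    obtain ⟨u, hu⟩ : ∃ u, u = Function.update w v (w v - h) := ⟨_, rfl⟩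
    have huv : u v = w v - h := by rw [hu]; simp
    have hune : ∀ i, i ≠ v → u i = w i := by intro i hi; rw [hu]; simp [hi]
    have hu0 : ∀ i, 0 ≤ u i := by
      intro i
      by_cases hi : i = v
      · rw [hi, huv]; linarith
      · rw [hune i hi]; exact hw0 i
    have hus : ∑ i ∈ Finset.range t, u i = 1 - h := by
      rw [← hsum, ← Finset.add_sum_erase _ _ hv, ← Finset.add_sum_erase _ w hv, huv,
        Finset.sum_congr rfl fun i hi => hune i (Finset.ne_of_mem_erase hi)]
      ring
    have hlu : lagPoly E u = Λ - h * D := by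
      rw [hΛ, hD, Finset.mul_sum, Finset.sum_filter]
      unfold lagPoly
      rw [← Finset.sum_sub_distrib]
      refine Finset.sum_congr rfl fun A _ => ?_
      split_ifs with hvA
      · rw [← Finset.mul_prod_erase _ _ hvA, ← Finset.mul_prod_erase _ w hvA, huv,
          Finset.prod_congr rfl fun i hi => hune i (Finset.ne_of_mem_erase hi)]
        ring
      · rw [sub_zero]
        refine Finset.prod_congr rfl fun i hi => hune i ?_
        rintro rfl; exact hvA hi
    have h2 := hopt u hu0
    rw [hlu, hus] at h2
    have h3 := (pow_lower (k+1) h h0.le (h1.trans hwv1)).1.2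
    push_cast at h3
    have h4 := mul_le_mul_of_nonneg_left h3 hΛ0
    have h5 : h * ((k+1) * Λ) ≤ h * (D + (Λ * ((k+1)*k/2)) * h) := by
      have : Λ * (1 - ((k:ℝ) + 1) * h + (k + 1) * (k + 1 - 1) / 2 * h ^ 2) = Λ - h * ((k+1) * Λ) + h * ((Λ * ((k+1)*k/2)) * h) := by ring
      linarith
    exact le_of_mul_le_mul_left h5 h0
  apply le_of_forall_pos_le_add
  intro ε hε
  obtain ⟨c, hc⟩ : ∃ c, c = Λ * (((k:ℝ)+1)*k/2) := ⟨_, rfl⟩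
  have hc0 : 0 ≤ c := by rw [hc]; positivity
  have := hstep (min (w v) (ε/(c+1))) (lt_min hvpos (by positivity)) (min_le_left _ _)
  refine this.trans ?_
  rw [← hc]
  have h1 : c * min (w v) (ε/(c+1)) ≤ c * (ε/(c+1)) := by gcongr; exact min_le_right _ _
  have h2 : c * (ε/(c+1)) ≤ ε := by
    rw [mul_div_assoc', div_le_iff₀ (by positivity)]; nlinarith
  linarith

lemma le_choose_aux (n q : ℕ) (hq : 1 ≤ q) (hn : q + 1 ≤ n) : n ≤ n.choose q := by
  induction n generalizing q with
  | zero => omega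
  | succ m ih =>
    obtain ⟨p, rfl⟩ : ∃ p, q = p + 1 := ⟨q - 1, by omega⟩
    rcases Nat.lt_or_ge (p+1) m with h | h
    · have h1 := ih (p+1) (by omega) (by omega)
      have h2 : 0 < m.choose p := Nat.choose_pos (by omega)
      rw [Nat.choose_succ_succ']
      omega
    · have : m = p + 1 := by omega
      subst this
      simp

lemma size_bound (n q : ℕ) (hq : 1 ≤ q) (hn : q + 1 ≤ n)
    (h : 2^q * (n.choose q - 1) ≤ n.choose (q+1)) :
    ∃ K, n + 1 = (q+1) + K ∧ (q+1) * 2^q ≤ K + 1 ∧ 2^q ≤ n.choose q := by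
  obtain ⟨K, hK⟩ : ∃ K, n = q + K := ⟨n - q, by omega⟩
  have hCn := le_choose_aux n q hq hn
  have hmul := Nat.choose_succ_right_eq n q
  have hnq : n - q = K := by omega
  rw [hnq] at hmul
  obtain ⟨C, hC⟩ : ∃ C, n.choose q = C + 1 := ⟨n.choose q - 1, by omega⟩
  rw [hC] at h hmul hCn
  simp only [Nat.add_sub_cancel] at h
  obtain ⟨p, rfl⟩ : ∃ p, q = p + 1 := ⟨q - 1, by omega⟩
  obtain ⟨X, hX⟩ : ∃ X, X = (p+1+1) * 2^p := ⟨_, rfl⟩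
  have hX2 : (p+1+1) * 2^(p+1) = 2 * X := by rw [hX]; ring
  have hXp : 2^(p+1) ≤ X := by rw [hX, pow_succ, mul_comm]; exact Nat.mul_le_mul (by omega) le_rfl
  have h3 : 2 * X * C ≤ (C+1) * K := by
    rw [← hmul, ← hX2]
    calc _ = (2^(p+1) * C) * (p+1+1) := by ring
      _ ≤ _ := Nat.mul_le_mul_right _ h
  have hCpos : 1 ≤ C := by omega
  have hXK : X ≤ K := by
    by_contra hlt
    have h5 : (C+1) * K < (C+1) * X := Nat.mul_lt_mul_of_pos_left (by omega) (by omega)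
    have h4 : (C+1) * X ≤ 2 * X * C := by nlinarith
    omega
  have hCX : X + 1 ≤ C + 1 := by omega
  refine ⟨K, by omega, ?_, ?_⟩
  · rw [hX2]
    by_contra hlt
    have h5 : K + 2 ≤ 2 * X := by omega
    nlinarith
  · rw [hC]; omega

lemma lagPoly_bdd (E : Finset (Finset ℕ)) :
    BddAbove {x | ∃ n w, IsWeighting n w ∧ x = lagPoly E w} := by
  refine ⟨E.card, ?_⟩
  rintro x ⟨n, w, ⟨h0, h1, h2⟩, rfl⟩
  unfold lagPoly
  calc _ ≤ ∑ e ∈ E, (1:ℝ) := by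
        refine Finset.sum_le_sum fun A _ => Finset.prod_le_one (fun i _ => h0 i) fun i _ => ?_
        rcases Nat.lt_or_ge i n with h | h
        · rw [← h2]; exact Finset.single_le_sum (fun i _ => h0 i) (Finset.mem_range.2 h)
        · rw [h1 i h]; norm_num
    _ = _ := by simp

lemma lag_complete_ge (N r : ℕ) (hN : 0 < N) :
    (N.choose r : ℝ) / (N:ℝ)^r ≤ lag (completeG N r) := by
  apply le_csSup (lagPoly_bdd _)
  have hN' : (0:ℝ) < N := by exact_mod_cast hN
  refine ⟨N, fun i => if i < N then 1/(N:ℝ) else 0, ⟨?_, ?_, ?_⟩, ?_⟩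
  · intro i; simp only; split_ifs <;> positivity
  · intro i hi; simp [Nat.not_lt.2 hi]
  · rw [Finset.sum_congr rfl (g := fun _ => 1/(N:ℝ))]
    · simp [hN'.ne']
    · intro i hi; simp [Finset.mem_range.1 hi]
  · unfold lagPoly completeG
    rw [Finset.sum_congr rfl (g := fun _ => (1/(N:ℝ))^r)]
    · simp [div_eq_mul_inv]
    · intro A hA
      obtain ⟨h1, h2⟩ := Finset.mem_powersetCard.1 hA
      rw [← h2, ← Finset.prod_const]
      refine Finset.prod_congr rfl fun i hi => ?_
      simp [Finset.mem_range.1 (h1 hi)]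

lemma core (n q : ℕ) (hq : 1 ≤ q) (K : ℕ) (hK1 : n + 1 = (q+1) + K) (hK2 : (q+1) * 2^q ≤ K + 1)
    (hC : 2^q ≤ n.choose q) (E : Finset (Finset ℕ))
    (hE : E ⊆ (Finset.range (n+2)).powersetCard (q+2))
    (hm : (E.card : ℝ) ≤ ((n+1).choose (q+2) : ℝ) + (n.choose (q+1) : ℝ) -
      (2:ℝ)^q * ((n.choose q : ℝ) - 1)) (w : ℕ → ℝ) (hw0 : ∀ i, 0 ≤ w i)
    (hsum : ∑ i ∈ Finset.range (n+2), w i = 1)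
    (hopt : ∀ u : ℕ → ℝ, (∀ i, 0 ≤ u i) →
      lagPoly E u ≤ lagPoly E w * (∑ i ∈ Finset.range (n+2), u i)^(q+2)) :
    lagPoly E w * ((n:ℝ)+1)^(q+2) ≤ ((n+1).choose (q+2) : ℝ) := by
  obtain ⟨V, hV⟩ : ∃ V, V = Finset.range (n+2) := ⟨_, rfl⟩
  have hVc : V.card = n + 2 := by rw [hV]; simp
  obtain ⟨v, hvV, hvmax⟩ := Finset.exists_max_image V w (Finset.card_pos.1 (by omega))
  have hvpos : 0 < w v := by
    by_contra hneg
    have : ∑ i ∈ V, w i ≤ 0 := Finset.sum_nonpos fun i hi => (hvmax i hi).trans (not_lt.1 hneg)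
    rw [hV, hsum] at this
    linarith
  by_cases hlow : 4 ≤ (V.filter fun i => 2 * w i ≤ w v).card
  · obtain ⟨L, hL, hL4⟩ := Finset.exists_subset_card_eq hlow
    have hgrad := grad_bound E (n+2) (q+1) v w hE hw0 hsum hopt (hV ▸ hvV) hvpos
    rw [← hV] at hgrad
    have hUc : (V.erase v).card = n + 1 := by rw [Finset.card_erase_of_mem hvV]; omega
    have hlc := low_case (V.erase v) w (w v) (q+1) K (by omega) (by simpa using hK2)
      (by rw [hUc, hK1]) hvpos (fun i _ => hw0 i) (fun i hi => hvmax i (Finset.mem_of_mem_erase hi))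
      (by rw [← hsum, ← hV, ← Finset.add_sum_erase _ _ hvV]; ring) L
      (by
        intro i hi
        obtain ⟨h1, h2⟩ := Finset.mem_filter.1 (hL hi)
        refine Finset.mem_erase.2 ⟨?_, h1⟩
        rintro rfl
        linarith) hL4 (fun i hi => (Finset.mem_filter.1 (hL hi)).2)
    rw [hUc] at hlc
    simp only [Nat.add_sub_cancel] at hlc
    push_cast at hlc hgrad
    have hch : ((n:ℝ)+1) * n.choose (q+1) = (n+1).choose (q+2) * (q+2) := by
      exact_mod_cast Nat.add_one_mul_choose_eq n (q+1)
    have hpos : (0:ℝ) < (n+1)^(q+1) := by positivity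
    have hq2 : (0:ℝ) < q + 2 := by positivity
    have h1 : ((q:ℝ)+2) * lagPoly E w * (n+1)^(q+1) ≤ n.choose (q+1) := by
      refine le_trans ?_ hlc
      have : ((q:ℝ)+2) * lagPoly E w ≤ es (V.erase v) (q+1) w := by linarith
      gcongr
    have h2 := mul_le_mul_of_nonneg_left h1 (show (0:ℝ) ≤ n + 1 by positivity)
    rw [hch] at h2
    refine le_of_mul_le_mul_right ?_ hq2
    refine le_trans (le_of_eq ?_) h2
    ring
  · obtain ⟨b, hbV, hbmin⟩ := Finset.exists_min_image V w ⟨v, hvV⟩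
    have hc1 : (V.erase b).card = n + 1 := by rw [Finset.card_erase_of_mem hbV]; omega
    obtain ⟨a, haV, hamin⟩ := Finset.exists_min_image (V.erase b) w (Finset.card_pos.1 (by omega))
    have hc2 : ((V.erase b).erase a).card = n := by rw [Finset.card_erase_of_mem haV]; omega
    have hnpos : 0 < n := by omega
    obtain ⟨c, hcV, hcmin⟩ := Finset.exists_min_image ((V.erase b).erase a) w
      (Finset.card_pos.1 (by omega))
    have hab : a ≠ b := Finset.ne_of_mem_erase haV
    have haV' := Finset.mem_of_mem_erase haV
    have hca : c ≠ a := Finset.ne_of_mem_erase hcV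
    have hcb : c ≠ b := Finset.ne_of_mem_erase (Finset.mem_of_mem_erase hcV)
    have hcV' := Finset.mem_of_mem_erase (Finset.mem_of_mem_erase hcV)
    refine merge_case V E w n q (w v) a b c hVc (hV ▸ hE) (fun i _ => hw0 i) (hV ▸ hsum) hvmax
      haV' hbV hab hbmin (fun i hi hib => hamin i (Finset.mem_erase.2 ⟨hib, hi⟩)) ?_ hm
      (by exact_mod_cast hC)
    intro i hi hia hib hic
    by_contra hlt
    apply hlow
    have h1 := hcmin i (Finset.mem_erase.2 ⟨hia, Finset.mem_erase.2 ⟨hib, hi⟩⟩)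
    have h2 := hamin c (Finset.mem_of_mem_erase hcV)
    have h3 := hbmin a haV'
    have hsub : ({i, c, a, b} : Finset ℕ) ⊆ V.filter fun i => 2 * w i ≤ w v := by
      intro x hx
      simp only [Finset.mem_insert, Finset.mem_singleton] at hx
      rw [Finset.mem_filter]
      rcases hx with rfl | rfl | rfl | rfl
      · exact ⟨hi, by linarith⟩
      · exact ⟨hcV', by linarith⟩
      · exact ⟨haV', by linarith⟩
      · exact ⟨hbV, by linarith⟩
    have h4 : ({i, c, a, b} : Finset ℕ).card = 4 := by
      rw [Finset.card_insert_of_notMem (by simp [hic, hia, hib]),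
        Finset.card_insert_of_notMem (by simp [hca, hcb]), Finset.card_pair hab]
    rw [← h4]
    exact Finset.card_le_card hsub

/-- An r-graph on t vertices with m edges containing a clique of order t-2
satisfies λ(G) ≤ λ([t-1]^{(r)}), for C(t-1,r) ≤ m ≤ C(t-1,r)+C(t-2,r-1)-2^{r-2}(C(t-2,r-2)-1). -/
theorem stmt_9 (r m t : ℕ) (hr : 3 ≤ r) (hm : 0 < m) (ht : 0 < t)
    (h₁ : (t - 1).choose r ≤ m)
    (h₂ : (m : ℝ) ≤ ((t - 1).choose r : ℝ) + ((t - 2).choose (r - 1) : ℝ) -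
      (2 : ℝ) ^ (r - 2) * (((t - 2).choose (r - 2) : ℝ) - 1))
    (E : Finset (Finset ℕ)) (hE : E ⊆ (Finset.range t).powersetCard r)
    (hmE : E.card = m)
    (hclique : ∃ s : Finset ℕ, s.card = t - 2 ∧ s.powersetCard r ⊆ E) :
    lag E ≤ lag (completeG (t - 1) r) := by
  -- the clique hypothesis turns out not to be needed
  have hEn : E.Nonempty := Finset.card_pos.1 (by omega)
  obtain ⟨A, hA⟩ := hEn
  obtain ⟨hA1, hA2⟩ := Finset.mem_powersetCard.1 (hE hA)
  have htr : r ≤ t := by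
    have := Finset.card_le_card hA1
    rw [hA2, Finset.card_range] at this
    exact this
  obtain ⟨q, rfl⟩ : ∃ q, r = q + 2 := ⟨r - 2, by omega⟩
  obtain ⟨n, rfl⟩ : ∃ n, t = n + 2 := ⟨t - 2, by omega⟩
  have e1 : n + 2 - 1 = n + 1 := by omega
  have e2 : n + 2 - 2 = n := by omega
  have e3 : q + 2 - 1 = q + 1 := by omega
  have e4 : q + 2 - 2 = q := by omega
  rw [e1] at h₁ h₂ ⊢
  rw [e2, e3, e4] at h₂
  have hqn : q + 1 ≤ n := by
    by_contra hlt
    have hnq : n = q := by omega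
    subst hnq
    rw [Nat.choose_eq_zero_of_lt (show n + 1 < n + 2 by omega),
      Nat.choose_eq_zero_of_lt (show n < n + 1 by omega), Nat.choose_self] at h₂
    norm_num at h₂
    omega
  have hC1 : 1 ≤ n.choose q := Nat.choose_pos (by omega)
  have hbound : 2^q * (n.choose q - 1) ≤ n.choose (q+1) := by
    have h3 : ((n+1).choose (q+2) : ℝ) ≤ m := by exact_mod_cast h₁
    have h4 : (2:ℝ)^q * ((n.choose q : ℝ) - 1) ≤ n.choose (q+1) := by linarith
    have h5 : ((2^q * (n.choose q - 1) : ℕ) : ℝ) ≤ (n.choose (q+1) : ℕ) := by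
      push_cast [Nat.cast_sub hC1]; exact h4
    exact_mod_cast h5
  obtain ⟨K, hK1, hK2, hK3⟩ := size_bound n q (by omega) hqn hbound
  obtain ⟨w, hw0, hsum, hopt⟩ := exists_opt E (n+2) (q+2) (by omega) (by omega) hE
  have hcore := core n q (by omega) K hK1 hK2 hK3 E hE (by rw [hmE]; exact h₂) w hw0 hsum hopt
  have hL := lag_complete_ge (n+1) (q+2) (by omega)
  have hΛ : lagPoly E w ≤ lag (completeG (n+1) (q+2)) := by
    refine le_trans ?_ hL
    push_cast
    rw [le_div_iff₀ (by positivity)]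
    exact hcore
  have hΛ0 : 0 ≤ lagPoly E w :=
    Finset.sum_nonneg fun A _ => Finset.prod_nonneg fun i _ => hw0 i
  refine csSup_le ⟨_, 1, fun i => if i = 0 then 1 else 0, ⟨?_, ?_, ?_⟩, rfl⟩ ?_
  · intro i; simp only; split_ifs <;> norm_num
  · intro i hi; simp only; rw [if_neg (by omega)]
  · simp
  · rintro x ⟨N, u, ⟨hu0, hu1, hu2⟩, rfl⟩
    refine (hopt u hu0).trans (le_trans ?_ hΛ)
    have hle : ∑ i ∈ Finset.range (n+2), u i ≤ 1 := by
      rw [← hu2]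
      calc _ ≤ ∑ i ∈ Finset.range (max N (n+2)), u i :=
            Finset.sum_le_sum_of_subset_of_nonneg
              (Finset.range_subset_range.2 (le_max_right _ _)) fun i _ _ => hu0 i
        _ = _ := by
            symm
            apply Finset.sum_subset (Finset.range_subset_range.2 (le_max_left _ _))
            intro i _ hi
            exact hu1 i (by simpa using hi)
    exact mul_le_of_le_one_right hΛ0
      (pow_le_one₀ (Finset.sum_nonneg fun i _ => hu0 i) hle)
end

section
/- Let m and t be positive integers satisfying C(t−1,4) ≤ m ≤ C(t−1,4) + C(⌊(t−2)/2⌋, 3). If G is a 4-uniform hypergraph with m edges containing a clique of order t−1, then λ(G) = λ([t−1]^{(4)}). -/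
open Finset

lemma gibbs_aux (r s : ℝ) (hr : 0 < r) (hs : 0 < s) :
    r - s ≤ r * (Real.log r - Real.log s) := by
  have h := Real.log_le_sub_one_of_pos (div_pos hs hr)
  rw [Real.log_div hs.ne' hr.ne'] at h
  have h2 := mul_le_mul_of_nonneg_left h hr.le
  have h3 : r * (s / r - 1) = s - r := by field_simp
  rw [h3] at h2
  linarith

lemma ent_step {ι : Type*} [Fintype ι] [DecidableEq ι] (p : ℝ) (hp : 0 < p) (hp1 : p < 1)
    (a : ι → ℝ) (b : ι → ι → ℝ) (hb : ∀ y z, 0 ≤ b y z) (hsym : ∀ y z, b y z = b z y)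
    (hd : ∀ y, b y y = 0) (ha : ∀ y, ∑ z, b y z = a y) (a0 : ℝ) (ha0 : ∑ y, a y = a0) :
    0 ≤ a0 * (p * Real.log p + (1 - p) * Real.log (1 - p)) + a0 * Real.log a0
      - p * ∑ y, a y * Real.log (a y)
      + (1 - p) * (∑ y, ∑ z, b y z * Real.log (b y z) - 2 * ∑ y, a y * Real.log (a y)) := by
  have han : ∀ y, 0 ≤ a y := fun y => by rw [← ha]; exact sum_nonneg fun z _ => hb y z
  have hba : ∀ y z, b y z ≤ a y := fun y z => by
    rw [← ha]; exact single_le_sum (f := b y) (fun z _ => hb y z) (mem_univ z)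
  have haa : ∀ y, a y ≤ a0 := fun y => by
    rw [← ha0]; exact single_le_sum (f := a) (fun z _ => han z) (mem_univ y)
  rcases (sum_nonneg fun y _ => han y : 0 ≤ ∑ y, a y).eq_or_lt with h0 | h0
  · rw [ha0] at h0
    have h1 : ∀ y, a y = 0 := fun y => le_antisymm (h0 ▸ haa y) (han y)
    have h2 : ∀ y z, b y z = 0 := fun y z => le_antisymm (h1 y ▸ hba y z) (hb y z)
    simp [h1, h2, ← h0]
  rw [ha0] at h0
  have key : ∀ y z, ((if y = z then p * a y else 0) + (1 - p) * b y z) - a y * a z / a0 ≤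
      (if y = z then p * a y * (Real.log p + Real.log a0 - Real.log (a y)) else 0)
      + (1 - p) * b y z * (Real.log (1 - p) + Real.log (b y z) + Real.log a0
        - Real.log (a y) - Real.log (a z)) := by
    intro y z
    have hs : 0 ≤ a y * a z / a0 := div_nonneg (mul_nonneg (han y) (han z)) h0.le
    by_cases hyz : y = z
    · subst hyz
      simp only [if_true, hd]
      rcases (han y).eq_or_lt with h | h
      · simp [← h]
      · have := gibbs_aux (p * a y) (a y * a y / a0) (by positivity) (by positivity)
        rw [Real.log_mul hp.ne' h.ne', Real.log_div (by positivity) h0.ne',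
          Real.log_mul h.ne' h.ne'] at this
        linarith
    · simp only [hyz, if_false]
      rcases (hb y z).eq_or_lt with h | h
      · simp only [← h]; linarith
      · have h1 : 0 < a y := h.trans_le (hba y z)
        have h2 : 0 < a z := h.trans_le (hsym y z ▸ hba z y)
        have h3 : 0 < 1 - p := by linarith
        have := gibbs_aux ((1 - p) * b y z) (a y * a z / a0) (by positivity) (by positivity)
        rw [Real.log_mul h3.ne' h.ne', Real.log_div (by positivity) h0.ne',
          Real.log_mul h1.ne' h2.ne'] at this
        linarith
  have K := sum_le_sum fun y (_ : y ∈ (univ : Finset ι)) =>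
    sum_le_sum fun z (_ : z ∈ (univ : Finset ι)) => key y z
  have hb2 : ∑ y, ∑ z, b y z = a0 := by simp [ha, ha0]
  have e1 : ∑ y, ∑ z, (((if y = z then p * a y else 0) + (1 - p) * b y z) - a y * a z / a0)
      = 0 := by
    have : ∑ y, ∑ z, a y * a z / a0 = a0 := by
      simp only [← sum_div, ← mul_sum, ← sum_mul, ha0]; field_simp
    simp only [sum_sub_distrib, sum_add_distrib, this, ← mul_sum, hb2, sum_ite_eq, mem_univ,
      if_true, ha0]
    ring
  have e2 : ∑ y, ∑ z, b y z * Real.log (a y) = ∑ y, a y * Real.log (a y) := by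
    simp only [← sum_mul, ha]
  have e3 : ∑ y, ∑ z, b y z * Real.log (a z) = ∑ y, a y * Real.log (a y) := by
    rw [sum_comm]
    simp only [← sum_mul]
    refine sum_congr rfl fun z _ => ?_
    rw [← ha z]; simp only [hsym _ z]
  have e4 : ∑ y, ∑ z, ((if y = z then p * a y * (Real.log p + Real.log a0 - Real.log (a y)) else 0)
      + (1 - p) * b y z * (Real.log (1 - p) + Real.log (b y z) + Real.log a0
        - Real.log (a y) - Real.log (a z))) =
      (p * (Real.log p + Real.log a0) * ∑ y, a y - p * ∑ y, a y * Real.log (a y)) +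
      ((1 - p) * (Real.log (1 - p) + Real.log a0) * ∑ y, ∑ z, b y z
       + (1 - p) * ∑ y, ∑ z, b y z * Real.log (b y z)
       - (1 - p) * ∑ y, ∑ z, b y z * Real.log (a y)
       - (1 - p) * ∑ y, ∑ z, b y z * Real.log (a z)) := by
    simp only [sum_add_distrib, sum_ite_eq, mem_univ, if_true]
    simp only [mul_sum, ← sum_sub_distrib, ← sum_add_distrib]
    refine sum_congr rfl fun y _ => ?_
    congr 1
    · ring
    · exact sum_congr rfl fun z _ => by ring
  rw [e1, e4, hb2, ha0, e2, e3] at K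
  linarith

/-- Entropy bound for symmetric distributions on triples. -/
lemma ent_main {ι : Type*} [Fintype ι] [DecidableEq ι] (j : ℝ) (hj : 3 ≤ j)
    (x : ι → ℝ) (hx : ∀ i, 0 ≤ x i) (hx1 : ∑ i, x i ≤ 1) (Q : ℝ) (hQ : 0 < Q)
    (T : Finset (ι × ι × ι)) (q : ι → ι → ι → ℝ)
    (hq : ∀ a b c, q a b c = if (a, b, c) ∈ T then x a * x b * x c / Q else 0)
    (hs1 : ∀ a b c, q a b c = q b a c) (hs2 : ∀ a b c, q a b c = q a c b)
    (hd : ∀ a b, q a b b = 0) (hsum : ∑ a, ∑ b, ∑ c, q a b c = 1)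
    (hT : (T.card : ℝ) ≤ j * (j - 1) * (j - 2)) :
    Q ≤ (j - 1) * (j - 2) / j ^ 2 := by
  have hq0 : ∀ a b c, 0 ≤ q a b c := by
    intro a b c; rw [hq]; split_ifs
    · have := hx a; have := hx b; have := hx c; positivity
    · exact le_rfl
  have hsum3 : ∀ s : ℝ, s = ∑ a, ∑ b, ∑ c, q a b c → s = 1 := fun s h => h.trans hsum
  set q2 : ι → ι → ℝ := fun a b => ∑ c, q a b c with hq2
  set q1 : ι → ℝ := fun a => ∑ b, q2 a b with hq1
  have hq20 : ∀ a b, 0 ≤ q2 a b := fun a b => sum_nonneg fun c _ => hq0 a b c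
  have hq10 : ∀ a, 0 ≤ q1 a := fun a => sum_nonneg fun c _ => hq20 a c
  set A1 := ∑ a, q1 a * Real.log (q1 a) with hA1
  set A2 := ∑ a, ∑ b, q2 a b * Real.log (q2 a b) with hA2
  set A3 := ∑ a, ∑ b, ∑ c, q a b c * Real.log (q a b c) with hA3
  have hj0 : 0 < j := by linarith
  have hj1 : 0 < j - 1 := by linarith
  have hj2 : 0 < j - 2 := by linarith
  -- step 1
  have S1 := ent_step (1 / j) (by positivity) (by rw [div_lt_one hj0]; linarith) q1 q2 hq20
    (fun y z => by simp only [hq2, hs1 y z]) (fun y => by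
      simp only [hq2]; exact sum_eq_zero fun c _ => by rw [hs2, hs1, hs2, hs1, hs2, hs1] <;> first | exact hd _ _ | (rw [hs2, hs1]; exact hd _ _))
    (fun y => rfl) 1 hsum
  have S2 : 0 ≤ (1 / (j-1) * Real.log (1 / (j-1)) + (1 - 1/(j-1)) * Real.log (1 - 1/(j-1))) + A1
      - 1/(j-1) * A2 + (1 - 1/(j-1)) * (A3 - 2 * A2) := by
    have := sum_nonneg fun a (_ : a ∈ (univ : Finset ι)) =>
      ent_step (1 / (j-1)) (by positivity) (by rw [div_lt_one hj1]; linarith) (q2 a) (q a) (hq0 a)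
        (hs2 a) (hd a) (fun y => rfl) (q1 a) rfl
    simp only [sum_add_distrib, sum_sub_distrib, ← mul_sum, ← sum_mul] at this
    have h1 : ∑ a, q1 a = 1 := hsum
    rw [h1] at this
    linarith
  have S3 : - Real.log (j * (j - 1) * (j - 2)) ≤ A3 := by
    set M := j * (j - 1) * (j - 2) with hM
    have hM0 : 0 < M := by positivity
    have key : ∀ a b c, q a b c - (if (a, b, c) ∈ T then 1 / M else 0) ≤
        q a b c * Real.log (q a b c) + q a b c * Real.log M := by
      intro a b c
      rcases (hq0 a b c).eq_or_lt with h | h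
      · rw [← h]; split_ifs <;> simp; positivity
      · have hm : (a, b, c) ∈ T := by
          by_contra hm; rw [hq, if_neg hm] at h; exact lt_irrefl _ h
        rw [if_pos hm]
        have := gibbs_aux (q a b c) (1 / M) h (by positivity)
        rw [Real.log_div one_ne_zero hM0.ne', Real.log_one] at this
        linarith
    have K := sum_le_sum fun a (_ : a ∈ (univ : Finset ι)) =>
      sum_le_sum fun b (_ : b ∈ (univ : Finset ι)) =>
      sum_le_sum fun c (_ : c ∈ (univ : Finset ι)) => key a b c
    simp only [sum_add_distrib, sum_sub_distrib, ← sum_mul] at K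
    rw [hsum3 _ rfl] at K
    have hc : ∑ a, ∑ b, ∑ c, (if (a, b, c) ∈ T then 1 / M else 0) = T.card * (1 / M) := by
      have : ∑ t : ι × ι × ι, (if t ∈ T then 1 / M else 0) = T.card * (1 / M) := by
        simp
      rw [← this, Fintype.sum_prod_type]
      exact sum_congr rfl fun a _ => by rw [Fintype.sum_prod_type]
    rw [hc] at K
    have : T.card * (1 / M) ≤ 1 := by
      rw [mul_one_div, div_le_one hM0]; exact hT
    linarith
  have S4 : Real.log Q ≤ - A3 + 3 * A1 := by
    have e0 : ∀ a b c, q a b c * Real.log (q a b c) = q a b c * Real.log (x a) +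
        q a b c * Real.log (x b) + q a b c * Real.log (x c) - q a b c * Real.log Q := by
      intro a b c
      by_cases h : q a b c = 0
      · simp [h]
      · have h' := h
        rw [hq] at h'
        split_ifs at h' with hm
        · have h1 : x a ≠ 0 := by rintro h; simp [h] at h'
          have h2 : x b ≠ 0 := by rintro h; simp [h] at h'
          have h3 : x c ≠ 0 := by rintro h; simp [h] at h'
          have : Real.log (q a b c) = Real.log (x a) + Real.log (x b) + Real.log (x c) 
            - Real.log Q := by
            rw [hq, if_pos hm, Real.log_div (by positivity) hQ.ne', Real.log_mul (by positivity) h3,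
              Real.log_mul h1 h2]
          rw [this]; ring
        · exact absurd rfl h'
    have f1 : ∑ a, ∑ b, ∑ c, q a b c * Real.log (x a) = ∑ a, q1 a * Real.log (x a) := by
      simp only [← sum_mul, hq1, hq2]
    have f2 : ∑ a, ∑ b, ∑ c, q a b c * Real.log (x b) = ∑ a, q1 a * Real.log (x a) := by
      rw [← f1, sum_comm]
      exact sum_congr rfl fun a _ => sum_congr rfl fun b _ => sum_congr rfl fun c _ => by
        rw [hs1]
    have f3 : ∑ a, ∑ b, ∑ c, q a b c * Real.log (x c) = ∑ a, q1 a * Real.log (x a) := by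
      rw [← f2]
      refine sum_congr rfl fun a _ => ?_
      rw [sum_comm]
      exact sum_congr rfl fun b _ => sum_congr rfl fun c _ => by rw [hs2]
    have f0 : A3 = 3 * (∑ a, q1 a * Real.log (x a)) - Real.log Q := by
      rw [hA3]; simp only [e0, sum_add_distrib, sum_sub_distrib]
      rw [f1, f2, f3]
      simp only [← sum_mul]
      rw [hsum3 _ rfl]
      ring
    have g : ∀ a, q1 a - x a ≤ q1 a * Real.log (q1 a) - q1 a * Real.log (x a) := by
      intro a
      rcases (hq10 a).eq_or_lt with h | h
      · simp [← h, hx]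
      · have hxa : 0 < x a := by
          refine (hx a).lt_of_ne fun h0 => h.ne' ?_
          refine sum_eq_zero fun b _ => sum_eq_zero fun c _ => ?_
          rw [hq, ← h0]; simp
        have := gibbs_aux _ _ h hxa
        linarith
    have G := sum_le_sum fun a (_ : a ∈ (univ : Finset ι)) => g a
    simp only [sum_sub_distrib] at G
    have h1 : ∑ a, q1 a = 1 := hsum
    rw [h1] at G
    linarith
  -- combine
  have l1 : Real.log (1 / j) = - Real.log j := by simp
  have l2 : Real.log (1 - 1 / j) = Real.log (j - 1) - Real.log j := by
    rw [← Real.log_div hj1.ne' hj0.ne']; congr 1; field_simp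
  have l3 : Real.log (1 / (j - 1)) = - Real.log (j - 1) := by simp
  have l4 : Real.log (1 - 1 / (j - 1)) = Real.log (j - 2) - Real.log (j - 1) := by
    rw [← Real.log_div hj2.ne' hj1.ne']; congr 1; field_simp; ring
  have l5 : Real.log (j * (j - 1) * (j - 2)) = Real.log j + Real.log (j - 1) + Real.log (j - 2) := by
    rw [Real.log_mul (by positivity) hj2.ne', Real.log_mul hj0.ne' hj1.ne']
  rw [← Real.log_le_log_iff hQ (by positivity), Real.log_div (by positivity) (by positivity),
    Real.log_mul hj1.ne' hj2.ne', Real.log_pow]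
  push_cast
  rw [l1, l2, Real.log_one] at S1
  rw [l3, l4] at S2
  rw [l5] at S3
  generalize Real.log j = u at *
  generalize Real.log (j - 1) = v at *
  generalize Real.log (j - 2) = w at *
  generalize Real.log Q = z at *
  change 0 ≤ 1 * _ + _ - 1 / j * A1 + (1 - 1 / j) * (A2 - 2 * A1) at S1
  have k1 : 0 ≤ j * (- A1 - u) - (j - 1) * (A1 - A2 - v) := by
    have := mul_le_mul_of_nonneg_left S1 hj0.le
    have e : j * (1 * (1 / j * -u + (1 - 1 / j) * (v - u)) + 1 * 0 - 1 / j * A1 + (1 - 1 / j) * (A2 - 2 * A1)) = j * (- A1 - u) - (j - 1) * (A1 - A2 - v) := by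
      field_simp; ring
    linarith
  have k2 : 0 ≤ (j - 1) * (A1 - A2 - v) - (j - 2) * (A2 - A3 - w) := by
    have := mul_le_mul_of_nonneg_left S2 hj1.le
    have e : (j - 1) * (1 / (j - 1) * -v + (1 - 1 / (j - 1)) * (w - v) + A1 - 1 / (j - 1) * A2 +
        (1 - 1 / (j - 1)) * (A3 - 2 * A2)) = (j - 1) * (A1 - A2 - v) - (j - 2) * (A2 - A3 - w) := by
      field_simp; ring
    linarith
  have k3 : (-A1 - u) + (A1 - A2 - v) + (A2 - A3 - w) ≤ 0 := by linarith
  have k4 : z ≤ - A3 + 3 * A1 := S4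
  suffices (A1 - A2 - v) + (A2 - A3 - w) ≤ 2 * (-A1 - u) by linarith
  generalize -A1 - u = a at *
  generalize A1 - A2 - v = b at *
  generalize A2 - A3 - w = c at *
  by_cases ha : 0 ≤ a
  · linarith
  · push Not at ha
    have hb : b ≤ a := by
      by_contra hb; push Not at hb; nlinarith
    have hc : c ≤ b := by
      by_contra hc; push Not at hc; nlinarith
    linarith

lemma choose_three_real (j : ℕ) : 6 * (j.choose 3 : ℝ) = j * (j - 1) * (j - 2) := by
  induction j with
  | zero => simp
  | succ k ih =>
    rw [Nat.choose_succ_succ' k 2]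
    push_cast
    rw [mul_add, ih, Nat.cast_choose_two]
    ring

lemma choose_four_real (j : ℕ) : 24 * (j.choose 4 : ℝ) = j * (j - 1) * (j - 2) * (j - 3) := by
  induction j with
  | zero => simp
  | succ k ih =>
    rw [Nat.choose_succ_succ' k 3]
    push_cast
    have := choose_three_real k
    linarith

/-- The triples of `V` whose underlying set is an edge. -/
def triples (V : Finset ℕ) (L : Finset (Finset ℕ)) : Finset (V × V × V) :=
  univ.filter fun t => ({t.1.1, t.2.1.1, t.2.2.1} : Finset ℕ) ∈ L

lemma triples_sum (V : Finset ℕ) (L : Finset (Finset ℕ)) (hL : L ⊆ V.powersetCard 3)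
    (g : Finset ℕ → ℝ) :
    ∑ t ∈ triples V L, g {t.1.1, t.2.1.1, t.2.2.1} = 6 * ∑ e ∈ L, g e := by
  rw [← sum_fiberwise_of_maps_to (s := triples V L) (t := L)
    (g := fun t => ({t.1.1, t.2.1.1, t.2.2.1} : Finset ℕ)) (fun t ht => (mem_filter.1 ht).2), mul_sum]
  refine sum_congr rfl fun e he => ?_
  have h1 : ∀ t ∈ (triples V L).filter
      (fun t => ({t.1.1, t.2.1.1, t.2.2.1} : Finset ℕ) = e),
      g {t.1.1, t.2.1.1, t.2.2.1} = g e := fun t ht => by rw [(mem_filter.1 ht).2]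
  rw [sum_congr rfl h1, sum_const, nsmul_eq_mul]
  congr 1
  obtain ⟨hV, hc⟩ := mem_powersetCard.1 (hL he)
  obtain ⟨a, b, c, hab, hac, hbc, rfl⟩ := card_eq_three.1 hc
  have ha : a ∈ V := hV (by simp)
  have hb : b ∈ V := hV (by simp)
  have hcV : c ∈ V := hV (by simp)
  let A : V := ⟨a, ha⟩
  let B : V := ⟨b, hb⟩
  let C : V := ⟨c, hcV⟩
  have hAB : A ≠ B := fun h => hab (congrArg Subtype.val h)
  have hAC : A ≠ C := fun h => hac (congrArg Subtype.val h)
  have hBC : B ≠ C := fun h => hbc (congrArg Subtype.val h)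
  have hf : (triples V L).filter (fun t => ({t.1.1, t.2.1.1, t.2.2.1} : Finset ℕ) = {a, b, c}) =
      {(A, B, C), (A, C, B), (B, A, C), (B, C, A), (C, A, B), (C, B, A)} := by
    ext ⟨⟨x, hx⟩, ⟨y, hy⟩, ⟨z, hz⟩⟩
    simp only [triples, mem_filter, mem_univ, true_and, mem_insert, mem_singleton, Prod.mk.injEq,
      A, B, C, Subtype.mk.injEq]
    constructor
    · rintro ⟨-, h⟩
      have h1 : x ∈ ({a, b, c} : Finset ℕ) := by rw [← h]; simp
      have h2 : y ∈ ({a, b, c} : Finset ℕ) := by rw [← h]; simp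
      have h3 : z ∈ ({a, b, c} : Finset ℕ) := by rw [← h]; simp
      have h4 : a ∈ ({x, y, z} : Finset ℕ) := by rw [h]; simp
      have h5 : b ∈ ({x, y, z} : Finset ℕ) := by rw [h]; simp
      have h6 : c ∈ ({x, y, z} : Finset ℕ) := by rw [h]; simp
      simp only [mem_insert, mem_singleton] at h1 h2 h3 h4 h5 h6
      clear h he hc hV h1 
      grind
    · intro h
      have : ({x, y, z} : Finset ℕ) = {a, b, c} := by
        rcases h with ⟨rfl, rfl, rfl⟩ | ⟨rfl, rfl, rfl⟩ | ⟨rfl, rfl, rfl⟩ | ⟨rfl, rfl, rfl⟩ |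
          ⟨rfl, rfl, rfl⟩ | ⟨rfl, rfl, rfl⟩ <;> ext u <;> simp only [mem_insert, mem_singleton] <;> tauto
      exact ⟨this ▸ he, this⟩
  rw [hf]
  have : #({(A, B, C), (A, C, B), (B, A, C), (B, C, A), (C, A, B), (C, B, A)} : Finset (V × V × V))
      = 6 := by
    repeat rw [card_insert_of_notMem (by
      simp only [mem_insert, mem_singleton, Prod.mk.injEq]; grind)]
    simp
  rw [this]; norm_num

lemma three_graph_bound (V : Finset ℕ) (L : Finset (Finset ℕ)) (hL : L ⊆ V.powersetCard 3)
    (w : ℕ → ℝ) (hw : ∀ i, 0 ≤ w i) (j : ℕ) (hj : 3 ≤ j) (hc : #L ≤ j.choose 3) :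
    6 * lagPoly L w ≤ (j - 1) * (j - 2) / j ^ 2 * (∑ i ∈ V, w i) ^ 3 := by
  have hjr : (3 : ℝ) ≤ j := by exact_mod_cast hj
  set W := ∑ i ∈ V, w i with hW
  have hW0 : 0 ≤ W := sum_nonneg fun i _ => hw i
  have hP0 : 0 ≤ lagPoly L w := sum_nonneg fun e _ => prod_nonneg fun i _ => hw i
  rcases hP0.eq_or_lt with hP | hP
  · rw [← hP, mul_zero]
    have h1 : (0 : ℝ) ≤ j - 1 := by linarith
    have h2 : (0 : ℝ) ≤ j - 2 := by linarith
    positivity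
  have hWp : 0 < W := by
    refine hW0.lt_of_ne fun h => hP.ne' ?_
    have hz : ∀ i ∈ V, w i = 0 := (sum_eq_zero_iff_of_nonneg fun i _ => hw i).1 (hW ▸ h.symm)
    refine sum_eq_zero fun e he => ?_
    obtain ⟨hV, h3⟩ := mem_powersetCard.1 (hL he)
    obtain ⟨i, hi⟩ : e.Nonempty := card_pos.1 (by omega)
    exact prod_eq_zero hi (hz i (hV hi))
  set Q := 6 * lagPoly L w / W ^ 3 with hQ
  have hprod : ∀ t ∈ triples V L, ∏ i ∈ ({t.1.1, t.2.1.1, t.2.2.1} : Finset ℕ), w i =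
      w t.1 * w t.2.1 * w t.2.2 ∧ t.1 ≠ t.2.1 ∧ t.1 ≠ t.2.2 ∧ t.2.1 ≠ t.2.2 := by
    rintro ⟨⟨x, hx⟩, ⟨y, hy⟩, ⟨z, hz⟩⟩ ht
    have h3 := (mem_powersetCard.1 (hL (mem_filter.1 ht).2)).2
    simp only at h3
    have hxy : x ≠ y := by
      rintro rfl
      have : #({x, x, z} : Finset ℕ) ≤ 2 := by simpa using card_le_two
      omega
    have hxz : x ≠ z := by
      rintro rfl
      have : #({x, y, x} : Finset ℕ) ≤ 2 := by
        rw [insert_eq_of_mem (by simp)]; exact card_le_two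
      omega
    have hyz : y ≠ z := by
      rintro rfl
      have : #({x, y, y} : Finset ℕ) ≤ 2 := by simpa using card_le_two
      omega
    refine ⟨?_, ?_, ?_, ?_⟩
    · rw [prod_insert (by simp [hxy, hxz]), prod_insert (by simp [hyz]), prod_singleton]
      ring
    · simpa using hxy
    · simpa using hxz
    · simpa using hyz
  have hmem1 : ∀ a b c : V, (a, b, c) ∈ triples V L ↔ (b, a, c) ∈ triples V L := by
    intro a b c
    simp only [triples, mem_filter, mem_univ, true_and]
    rw [insert_comm]
  have hmem2 : ∀ a b c : V, (a, b, c) ∈ triples V L ↔ (a, c, b) ∈ triples V L := by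
    intro a b c
    simp only [triples, mem_filter, mem_univ, true_and]
    rw [pair_comm]
  have main := ent_main (ι := V) (j : ℝ) hjr (fun i => w i / W) (fun i => div_nonneg (hw i) hW0)
    (by rw [← sum_div, sum_coe_sort V w, ← hW, div_self hWp.ne']) Q (by positivity) (triples V L)
    (fun a b c => if (a, b, c) ∈ triples V L then (w a / W) * (w b / W) * (w c / W) / Q else 0)
    (fun a b c => rfl)
    (fun a b c => by simp only [hmem1 a b c]; congr 1; ring)
    (fun a b c => by simp only [hmem2 a b c]; congr 1; ring)
    (fun a b => if_neg fun h => (hprod _ h).2.2.2 rfl)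
    (by
      have h1 := triples_sum V L hL (fun e => ∏ i ∈ e, w i)
      rw [sum_congr rfl fun t ht => (hprod t ht).1] at h1
      have h2 : ∑ t ∈ triples V L, (w t.1 / W) * (w t.2.1 / W) * (w t.2.2 / W) / Q = 1 := by
        have : ∀ t : V × V × V, (w t.1 / W) * (w t.2.1 / W) * (w t.2.2 / W) / Q =
          (w t.1 * w t.2.1 * w t.2.2) / (W ^ 3 * Q) := fun t => by field_simp
        simp only [this]
        rw [← sum_div, h1, hQ]
        change 6 * lagPoly L w / _ = 1
        field_simp
      rw [← h2, ← Fintype.sum_ite_mem (triples V L), Fintype.sum_prod_type]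
      exact sum_congr rfl fun a _ => by rw [Fintype.sum_prod_type])
    (by
      have h1 := triples_sum V L hL (fun _ => 1)
      simp only [sum_const, nsmul_eq_mul, mul_one] at h1
      rw [h1, ← choose_three_real]
      have : (#L : ℝ) ≤ j.choose 3 := by exact_mod_cast hc
      linarith)
  rw [hQ, div_le_iff₀ (by positivity)] at main
  exact main

lemma tangent_pow (A B : ℝ) (hA : 0 ≤ A) (hB : 0 ≤ B) (k : ℕ) :
    A ^ k * ((k + 1) * B - k * A) ≤ B ^ (k + 1) := by
  induction k with
  | zero => simp
  | succ k ih =>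
    have h1 := mul_le_mul_of_nonneg_right ih hB
    have h2 : 0 ≤ (k + 1) * (A ^ k * (B - A) ^ 2) := by positivity
    have h3 : B ^ (k + 1 + 1) = B ^ (k + 1) * B := pow_succ _ _
    rw [h3]
    refine le_trans ?_ h1
    push_cast
    rw [pow_succ]
    nlinarith

lemma lagPoly_insert (S : Finset ℕ) (v : ℕ) (hv : v ∉ S) (k : ℕ) (w : ℕ → ℝ) :
    lagPoly ((insert v S).powersetCard (k + 1)) w =
      lagPoly (S.powersetCard (k + 1)) w + w v * lagPoly (S.powersetCard k) w := by
  have hn : ∀ e ∈ S.powersetCard k, v ∉ e := fun e he h => hv ((mem_powersetCard.1 he).1 h)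
  unfold lagPoly
  rw [powersetCard_succ_insert hv, sum_union, sum_image, mul_sum]
  · congr 1
    exact sum_congr rfl fun e he => prod_insert (hn e he)
  · intro e he f hf h
    rw [← erase_insert (hn e he), ← erase_insert (hn f hf)]
    exact congrArg (fun s => erase s v) h
  · rw [disjoint_left]
    intro e he he'
    obtain ⟨f, -, rfl⟩ := mem_image.1 he'
    exact hv ((mem_powersetCard.1 he).1 (mem_insert_self _ _))

lemma maclaurin_s10 (w : ℕ → ℝ) (hw : ∀ i, 0 ≤ w i) (S : Finset ℕ) : ∀ r : ℕ,
    lagPoly (S.powersetCard r) w ≤ ((#S).choose r : ℝ) / (#S : ℝ) ^ r * (∑ i ∈ S, w i) ^ r := by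
  induction S using Finset.induction_on with
  | empty =>
    intro r
    cases r with
    | zero => simp [lagPoly]
    | succ k => rw [powersetCard_eq_empty.2 (by simp)]; simp [lagPoly]
  | insert v S hv ih =>
    intro r
    cases r with
    | zero => simp [lagPoly]
    | succ k =>
      rw [lagPoly_insert S v hv, card_insert_of_notMem hv, sum_insert hv]
      have h1 := ih (k + 1)
      have h2 := mul_le_mul_of_nonneg_left (ih k) (hw v)
      refine (add_le_add h1 h2).trans ?_
      set a := ∑ i ∈ S, w i with ha
      have ha0 : 0 ≤ a := sum_nonneg fun i _ => hw i
      have hy := hw v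
      generalize w v = y at *
      rcases Nat.eq_zero_or_pos (#S) with h0 | h0
      · have : a = 0 := by rw [ha, card_eq_zero.1 h0, sum_empty]
        rw [h0, this]
        cases k
        · simp
        · simp; positivity
      · generalize #S = n at *
        have hn : (0 : ℝ) < n := by exact_mod_cast h0
        have c1 : ((n + 1).choose (k + 1) : ℝ) = (n + 1) * n.choose k / (k + 1) := by
          have := Nat.add_one_mul_choose_eq n k
          field_simp
          exact_mod_cast this.symm
        have c2 : (n.choose (k + 1) : ℝ) = (n - k) * n.choose k / (k + 1) := by
          have : (n.choose (k + 1) : ℝ) = (n + 1).choose (k + 1) - n.choose k := by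
            rw [Nat.choose_succ_succ']; push_cast; ring
          rw [this, c1]; field_simp; ring
        rw [c1, c2]
        have T := tangent_pow ((n + 1) * a) (n * (y + a)) (by positivity) (by positivity) k
        have C0 : (0 : ℝ) ≤ n.choose k / (n ^ (k + 1) * (n + 1) ^ k * (k + 1)) := by positivity
        have T2 := mul_le_mul_of_nonneg_left T C0
        push_cast
        calc _ = _ := ?_
          _ ≤ _ := T2
          _ = _ := ?_
        · rw [mul_pow]; field_simp; ring
        · rw [mul_pow]; field_simp; ring

lemma numeric (j n : ℕ) (hj : 3 ≤ j) (hn : 2 * j + 1 ≤ n) :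
    ((j : ℝ) - 1) * (j - 2) / j ^ 2 ≤ 24 * ((n.choose 4 : ℝ) / n ^ 4) := by
  obtain ⟨i, rfl⟩ := Nat.exists_eq_add_of_le hj
  obtain ⟨d, rfl⟩ := Nat.exists_eq_add_of_le hn
  rw [← mul_div_assoc, choose_four_real, div_le_div_iff₀ (by positivity) (by positivity)]
  push_cast
  rw [← sub_nonneg]
  ring_nf
  positivity

lemma upper (S : Finset ℕ) (w : ℕ → ℝ) (hw : ∀ i, 0 ≤ w i) (U : Finset ℕ) :
    ∀ E : Finset (Finset ℕ), Disjoint U S → E ⊆ (U ∪ S).powersetCard 4 →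
      #(E \ S.powersetCard 4) ≤ ((#S - 1) / 2).choose 3 →
      lagPoly E w ≤ ((#S).choose 4 : ℝ) / (#S : ℝ) ^ 4 * (∑ i ∈ U ∪ S, w i) ^ 4 := by
  induction U using Finset.induction_on with
  | empty =>
    intro E _ hE _
    rw [empty_union] at *
    exact (sum_le_sum_of_subset_of_nonneg hE fun e _ _ => prod_nonneg fun i _ => hw i).trans
      (maclaurin_s10 w hw S 4)
  | insert v U hv ih =>
    intro E hd hE hc
    rw [disjoint_insert_left] at hd
    obtain ⟨hvS, hd⟩ := hd
    have hvU : v ∉ U ∪ S := by simp [hv, hvS]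
    rw [insert_union, sum_insert hvU]
    rw [insert_union] at hE
    set a := ∑ i ∈ U ∪ S, w i with ha
    have ha0 : 0 ≤ a := sum_nonneg fun i _ => hw i
    set Λ := ((#S).choose 4 : ℝ) / (#S : ℝ) ^ 4 with hΛ
    have hΛ0 : 0 ≤ Λ := by positivity
    have hB := ih (E.filter (v ∉ ·)) hd (by
      intro e he
      obtain ⟨he, hve⟩ := mem_filter.1 he
      obtain ⟨h1, h2⟩ := mem_powersetCard.1 (hE he)
      exact mem_powersetCard.2 ⟨(subset_insert_iff_of_notMem hve).1 h1, h2⟩)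
      ((card_le_card (sdiff_subset_sdiff (filter_subset _ _) subset_rfl)).trans hc)
    set L := (E.filter (v ∈ ·)).image (fun e => e.erase v) with hLdef
    have hsplit : lagPoly E w = lagPoly (E.filter (v ∉ ·)) w + w v * lagPoly L w := by
      unfold lagPoly
      rw [← sum_filter_add_sum_filter_not E (v ∈ ·), add_comm, hLdef, sum_image, mul_sum]
      · congr 1
        exact sum_congr rfl fun e he => (mul_prod_erase e w (mem_filter.1 he).2).symm
      · intro e he f hf h
        rw [← insert_erase (mem_filter.1 he).2, ← insert_erase (mem_filter.1 hf).2]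
        exact congrArg (insert v) h
    have hLsub : L ⊆ (U ∪ S).powersetCard 3 := by
      intro f hf
      obtain ⟨e, he, rfl⟩ := mem_image.1 hf
      obtain ⟨he, hve⟩ := mem_filter.1 he
      obtain ⟨h1, h2⟩ := mem_powersetCard.1 (hE he)
      exact mem_powersetCard.2 ⟨subset_insert_iff.1 h1, by rw [card_erase_of_mem hve, h2]⟩
    have hLc : #L ≤ ((#S - 1) / 2).choose 3 := by
      refine card_image_le.trans (le_trans (card_le_card ?_) hc)
      intro e he
      obtain ⟨he, hve⟩ := mem_filter.1 he
      exact mem_sdiff.2 ⟨he, fun h => hvS ((mem_powersetCard.1 h).1 hve)⟩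
    have hA : lagPoly L w ≤ 4 * Λ * a ^ 3 := by
      by_cases hj : 3 ≤ (#S - 1) / 2
      · have h1 := three_graph_bound (U ∪ S) L hLsub w hw _ hj hLc
        have h2 := numeric _ (#S) hj (by omega)
        have h3 := mul_le_mul_of_nonneg_right h2 (pow_nonneg ha0 3)
        linarith
      · rw [Nat.choose_eq_zero_of_lt (by omega)] at hLc
        have : L = ∅ := card_eq_zero.1 (by omega)
        rw [this]
        simp only [lagPoly, sum_empty]
        positivity
    rw [hsplit]
    have hy := hw v
    have h1 := mul_le_mul_of_nonneg_left hA hy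
    have h2 : 0 ≤ Λ * (6 * w v ^ 2 * a ^ 2 + 4 * w v ^ 3 * a + w v ^ 4) := by positivity
    nlinarith

lemma lag_eq (E : Finset (Finset ℕ)) (huni : ∀ e ∈ E, e.card = 4) (S : Finset ℕ) (hS : 0 < #S)
    (hSE : S.powersetCard 4 ⊆ E) (hc : #E ≤ (#S).choose 4 + ((#S - 1) / 2).choose 3) :
    lag E = ((#S).choose 4 : ℝ) / (#S : ℝ) ^ 4 := by
  have hSr : (0 : ℝ) < #S := by exact_mod_cast hS
  have hub : ∀ n w, IsWeighting n w → lagPoly E w ≤ ((#S).choose 4 : ℝ) / (#S : ℝ) ^ 4 := by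
    rintro n w ⟨hw, hz, h1⟩
    set U := (range n ∪ E.biUnion id) \ S with hU
    have h := upper S w hw U E sdiff_disjoint (by
      intro e he
      refine mem_powersetCard.2 ⟨?_, huni e he⟩
      intro i hi
      simp only [hU, sdiff_union_self_eq_union, mem_union, mem_biUnion]
      exact Or.inl (Or.inr ⟨e, he, hi⟩)) (by
      rw [card_sdiff_of_subset hSE, card_powersetCard]; omega)
    have hs : ∑ i ∈ U ∪ S, w i = 1 := by
      rw [← h1]
      symm
      refine sum_subset ?_ fun i _ hi => hz i (by simpa using hi)
      intro i hi
      simp only [hU, sdiff_union_self_eq_union, mem_union]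
      exact Or.inl (Or.inl hi)
    rwa [hs, one_pow, mul_one] at h
  have hex : ∃ n w, IsWeighting n w ∧ ((#S).choose 4 : ℝ) / (#S : ℝ) ^ 4 ≤ lagPoly E w := by
    obtain ⟨n, hn⟩ := S.exists_nat_subset_range
    refine ⟨n, fun i => if i ∈ S then 1 / (#S : ℝ) else 0, ⟨?_, ?_, ?_⟩, ?_⟩
    · intro i; dsimp only; split_ifs <;> positivity
    · intro i hi
      exact if_neg fun h => absurd (mem_range.1 (hn h)) (by omega)
    · rw [sum_ite_mem, inter_eq_right.2 hn, sum_const, nsmul_eq_mul]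
      field_simp
    · refine le_trans (le_of_eq ?_) (sum_le_sum_of_subset_of_nonneg hSE fun e _ _ =>
        prod_nonneg fun i _ => by split_ifs <;> positivity)
      have : ∀ e ∈ S.powersetCard 4, ∏ i ∈ e, (if i ∈ S then 1 / (#S : ℝ) else 0) =
          (1 / (#S : ℝ)) ^ 4 := by
        intro e he
        obtain ⟨h1, h2⟩ := mem_powersetCard.1 he
        rw [prod_congr rfl fun i hi => if_pos (h1 hi), prod_const, h2]
      rw [sum_congr rfl this, sum_const, card_powersetCard, nsmul_eq_mul]
      field_simp
  obtain ⟨n, w, hw, hle⟩ := hex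
  have hg : IsGreatest {x | ∃ n w, IsWeighting n w ∧ x = lagPoly E w}
      (((#S).choose 4 : ℝ) / (#S : ℝ) ^ 4) := by
    refine ⟨⟨n, w, hw, le_antisymm hle (hub n w hw)⟩, ?_⟩
    rintro x ⟨n, w, hw, rfl⟩
    exact hub n w hw
  exact hg.csSup_eq

/-- A 4-graph with m edges containing a clique of order t-1 satisfies
λ(G) = λ([t-1]^{(4)}), for C(t-1,4) ≤ m ≤ C(t-1,4) + C(⌊(t-2)/2⌋,3). -/
theorem stmt_10 (m t : ℕ) (hm : 0 < m) (ht : 0 < t)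
    (h₁ : (t - 1).choose 4 ≤ m)
    (h₂ : m ≤ (t - 1).choose 4 + ((t - 2) / 2).choose 3)
    (E : Finset (Finset ℕ)) (huni : ∀ e ∈ E, e.card = 4) (hmE : E.card = m)
    (hclique : ∃ s : Finset ℕ, s.card = t - 1 ∧ s.powersetCard 4 ⊆ E) :
    lag E = lag (completeG (t - 1) 4) := by
  obtain ⟨s, hs, hsE⟩ := hclique
  have ht2 : 0 < t - 1 := by
    by_contra h
    have h0 : t = 1 := by omega
    subst h0
    simp at h₂
    omega
  have ht3 : t - 2 = t - 1 - 1 := by omega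
  rw [lag_eq E huni s (by omega) hsE (by rw [hs, ← ht3]; omega),
    lag_eq (completeG (t - 1) 4) (fun e he => (mem_powersetCard.1 he).2) (range (t - 1))
      (by simpa using ht2) subset_rfl (by simp [completeG]), hs, card_range]
end

section
/- Let m and t be positive integers with C(t−1,3) ≤ m ≤ C(t−1,3) + C(t−2,2). Let G be a left-compressed 3-graph on vertex set [t] with m edges not containing a clique of order t−1, such that the symmetric difference of the edge sets of G and of the colex graph C_{3,m} has size at most 6. Then λ(G) < λ([t−1]^{(3)}). -/
open Finset

/-- A hypergraph is left-compressed if replacing any vertex of an edge by a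
smaller vertex (not already in the edge) again yields an edge. -/
def LeftCompressed (E : Finset (Finset ℕ)) : Prop :=
  ∀ e ∈ E, ∀ j ∈ e, ∀ i < j, i ∉ e → insert i (e.erase j) ∈ E

/-- Binary encoding of a finite set; A < B in colex order iff binVal A < binVal B. -/
def binVal (A : Finset ℕ) : ℕ := ∑ i ∈ A, 2 ^ i

/-- C_{r,m}: the r-graph consisting of the first m r-sets in the colex ordering. -/
def colexGraph (r m : ℕ) : Finset (Finset ℕ) :=
  ((Finset.range (r + m)).powersetCard r).filter
    (fun A => (((Finset.range (r + m)).powersetCard r).filter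
      (fun B => binVal B < binVal A)).card < m)

theorem Q2 (a c s : ℝ) (ha : 0 ≤ a) (hc : 0 ≤ c) (hs : 0 ≤ s) :
  0.1 ≤ 2*(a-1)^2*(6+s+2*c)+2*(c-1)^2*(6+s+2*a)+(s-1)^2*(1+4*a+4*c) - 3*a*s^2+6*s*c^2 := by
  linarith [mul_nonneg hs (sq_nonneg (2*a+(1)*c+(0)*s+(-143/50))),
    mul_nonneg hs (sq_nonneg (1*a+(-2)*c+(0)*s+(3/25))),
    mul_nonneg hs (sq_nonneg (1*a+(2)*c+(0)*s+(-12/5))),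
    sq_nonneg (2*a+(-2)*c+(-1)*s+(14/25)),
    mul_nonneg hc (sq_nonneg (1*a+(0)*c+(-2)*s+(38/25))),
    mul_nonneg hc (sq_nonneg (2*a+(0)*c+(1)*s+(-183/50))),
    mul_nonneg hs (sq_nonneg (0*a+(1)*c+(0)*s+(-29/50))),
    sq_nonneg (2*a+(-1)*c+(0)*s+(-3/2)),
    sq_nonneg (2*a+(1)*c+(0)*s+(-153/50)),
    sq_nonneg (1*a+(0)*c+(0)*s+(-57/50)),
    mul_nonneg hc (sq_nonneg (1*a+(0)*c+(0)*s+(-57/50))),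
    sq_nonneg (2*a+(2)*c+(1)*s+(-128/25)),
    sq_nonneg (1*a+(2)*c+(0)*s+(-13/5)),
    mul_nonneg ha (sq_nonneg (0*a+(2)*c+(1)*s+(-71/25))),
    mul_nonneg hc (sq_nonneg (2*a+(0)*c+(-1)*s+(-9/10)))]
theorem Q3 (a c s : ℝ) (ha : 0 ≤ a) (hc : 0 ≤ c) (hs : 0 ≤ s) :
  0.1 ≤ 3*(a-1)^2*(10+a+2*c+s)+2*(c-1)^2*(10+3*a+s)+(s-1)^2*(3+6*a+4*c) - 4.5*a*s^2+7.5*s*c^2 := by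
  linarith [mul_nonneg ha (sq_nonneg (2*a+(-2)*c+(-1)*s+(37/50))),
    mul_nonneg hs (sq_nonneg (2*a+(-1)*c+(0)*s+(-73/50))),
    sq_nonneg (2*a+(-2)*c+(-1)*s+(16/25)),
    sq_nonneg (2*a+(2)*c+(-1)*s+(-111/50)),
    mul_nonneg hs (sq_nonneg (1*a+(2)*c+(0)*s+(-129/50))),
    sq_nonneg (2*a+(-2)*c+(-1)*s+(37/50)),
    mul_nonneg ha (sq_nonneg (2*a+(2)*c+(1)*s+(-247/50))),
    mul_nonneg hc (sq_nonneg (2*a+(0)*c+(-1)*s+(-37/50))),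
    sq_nonneg (1*a+(2)*c+(0)*s+(-129/50)),
    mul_nonneg hc (sq_nonneg (1*a+(0)*c+(-2)*s+(81/50))),
    sq_nonneg (2*a+(-1)*c+(0)*s+(-73/50)),
    sq_nonneg (2*a+(2)*c+(1)*s+(-126/25)),
    mul_nonneg hc (sq_nonneg (2*a+(0)*c+(-1)*s+(-21/25))),
    sq_nonneg (2*a+(2)*c+(1)*s+(-247/50)),
    mul_nonneg ha (sq_nonneg (0*a+(2)*c+(1)*s+(-71/25))),
    mul_nonneg hs (sq_nonneg (1*a+(-2)*c+(0)*s+(19/50)))]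
theorem Q4 (a c s : ℝ) (ha : 0 ≤ a) (hc : 0 ≤ c) (hs : 0 ≤ s) (h : 12 * a ≤ s) :
  0.1 ≤ 3*(a-1)^2*(10+a+2*c+s)+2*(c-1)^2*(10+3*a+s)+(s-1)^2*(3+6*a+4*c) - 4.5*a*s^2+6*s*c^2 := by
  have h1 : 0.1 ≤ 30*a^2-78*a+30+3*(s-1)^2 := by
    rcases le_total (1/12) a with h2 | h2
    · nlinarith [mul_nonneg (sub_nonneg.2 h) (by linarith : (0:ℝ) ≤ s - 1 + (12 * a - 1)), sq_nonneg (a - 75/462)]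
    · nlinarith [sq_nonneg a, sq_nonneg (s-1)]
  have h3 : 0 ≤ 3*(a-1)^2*(a+2*c+s) := by positivity
  have h4 : 0 ≤ 2*(c-1)^2*(10+3*a+s) := by positivity
  have h5 : 0 ≤ (s-1)^2*(4*c) := by positivity
  have h6 : 0 ≤ 6*s*c^2 := by positivity
  have h7 : 0 ≤ a * (s-4)^2 := by positivity
  linarith

def psi (n x : ℝ) : ℝ := (x-1)^2*(3*n-4-2*x)

theorem psi_nonneg (n x : ℝ) (hn : 4 ≤ n) (hx : x ≤ n) : 0 ≤ psi n x :=
  mul_nonneg (sq_nonneg _) (by linarith)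

theorem psi_two (n x y : ℝ) : psi n x + psi n y = 2 * psi n ((x+y)/2) + (x-y)^2/4*(6*(n-(x+y))) := by
  unfold psi; ring

theorem psi_three (n x y z : ℝ) (hx : 0 ≤ x) (hy : 0 ≤ y) (hz : 0 ≤ z) (h : x + y + z ≤ n) :
    3 * psi n ((x+y+z)/3) ≤ psi n x + psi n y + psi n z := by
  have key : psi n x + psi n y + psi n z - 3 * psi n ((x+y+z)/3)
     = (n - (x+y+z)) * ((x-y)^2+(y-z)^2+(z-x)^2)
       + (2/9) * ((x+y+z)^3 - 27*x*y*z) := by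
    unfold psi; ring
  have h1 : 0 ≤ (n - (x+y+z)) * ((x-y)^2+(y-z)^2+(z-x)^2) :=
    mul_nonneg (by linarith) (by positivity)
  have h2 : 0 ≤ (x+y+z)^3 - 27*x*y*z := by
    nlinarith [mul_nonneg hx (sq_nonneg (y-z)), mul_nonneg hy (sq_nonneg (z-x)),
      mul_nonneg hz (sq_nonneg (x-y)), mul_nonneg hx (sq_nonneg (x-y)), mul_nonneg hy (sq_nonneg (y-z)),
      mul_nonneg hz (sq_nonneg (z-x)), mul_nonneg hx (sq_nonneg (x-z)), mul_nonneg hy (sq_nonneg (y-x)),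
      mul_nonneg hz (sq_nonneg (z-y))]
  linarith

theorem scal1 (n x0 x1 u v s : ℝ) (hn : 5 ≤ n) (h0 : 0 ≤ x0) (h1 : 0 ≤ x1) (hu : 0 ≤ u)
    (hv : 0 ≤ v) (hs : 0 ≤ s) (h : x0 + x1 + u + v + s ≤ n) :
    6 * ((x0+x1)*s^2/4 - s*u*v) + 0.1 ≤ psi n x0 + psi n x1 + psi n u + psi n v + psi n s := by
  have e1 := psi_two n x0 x1
  have e2 := psi_two n u v
  obtain ⟨a, ha⟩ : ∃ a, a = (x0+x1)/2 := ⟨_, rfl⟩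
  obtain ⟨c, hc⟩ : ∃ c, c = (u+v)/2 := ⟨_, rfl⟩
  have ha0 : 0 ≤ a := by rw [ha]; positivity
  have hc0 : 0 ≤ c := by rw [hc]; positivity
  rw [← ha] at e1
  rw [← hc] at e2
  have hT : 2 * a + 2 * c + s ≤ n := by rw [ha, hc]; linarith
  have b1 : 0 ≤ (x0-x1)^2/4*(6*(n-(x0+x1))) := mul_nonneg (by positivity) (by linarith)
  have b2 : 0 ≤ (u-v)^2/4*(6*(n-(u+v)-s)) := mul_nonneg (by positivity) (by linarith)
  have b3 : s*u*v = s*c^2 - s*((u-v)^2/4) := by rw [hc]; ring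
  have b4 : (x0+x1) = 2*a := by rw [ha]; ring
  have c1 : (a-1)^2*(6+s+2*c) ≤ psi n a := mul_le_mul_of_nonneg_left (by linarith) (sq_nonneg _)
  have c2 : (c-1)^2*(6+s+2*a) ≤ psi n c := mul_le_mul_of_nonneg_left (by linarith) (sq_nonneg _)
  have c3 : (s-1)^2*(1+4*a+4*c) ≤ psi n s := mul_le_mul_of_nonneg_left (by linarith) (sq_nonneg _)
  have q := Q2 a c s ha0 hc0 hs
  rw [b3, b4]
  linarith

theorem scal2 (n x0 x1 x2 u v s : ℝ) (hn : 7 ≤ n) (h0 : 0 ≤ x0) (h1 : 0 ≤ x1) (h2 : 0 ≤ x2) (hu : 0 ≤ u)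
    (hv : 0 ≤ v) (hs : 0 ≤ s) (h : x0 + x1 + x2 + u + v + s ≤ n) :
    6 * ((x0+x1+x2)*s^2/4 - 5/4*s*u*v) + 0.1 ≤
      psi n x0 + psi n x1 + psi n x2 + psi n u + psi n v + psi n s := by
  have e1 := psi_three n x0 x1 x2 h0 h1 h2 (by linarith)
  have e2 := psi_two n u v
  obtain ⟨a, ha⟩ : ∃ a, a = (x0+x1+x2)/3 := ⟨_, rfl⟩
  obtain ⟨c, hc⟩ : ∃ c, c = (u+v)/2 := ⟨_, rfl⟩
  have ha0 : 0 ≤ a := by rw [ha]; positivity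
  have hc0 : 0 ≤ c := by rw [hc]; positivity
  rw [← ha] at e1
  rw [← hc] at e2
  have hT : 3 * a + 2 * c + s ≤ n := by rw [ha, hc]; linarith
  have b4 : (x0+x1+x2) = 3*a := by rw [ha]; ring
  have c1 : (a-1)^2*(10+a+2*c+s) ≤ psi n a := mul_le_mul_of_nonneg_left (by linarith) (sq_nonneg _)
  have c2 : (c-1)^2*(10+3*a+s) ≤ psi n c := mul_le_mul_of_nonneg_left (by linarith) (sq_nonneg _)
  have c3 : (s-1)^2*(3+6*a+4*c) ≤ psi n s := mul_le_mul_of_nonneg_left (by linarith) (sq_nonneg _)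
  have b3 : s*u*v = s*c^2 - s*((u-v)^2/4) := by rw [hc]; ring
  rw [b4]
  rcases le_total (12 * a) s with h12 | h12
  · have q := Q4 a c s ha0 hc0 hs h12
    have b2 : 0 ≤ (u-v)^2/4*(6*(n-(u+v)-s)) := mul_nonneg (by positivity) (by linarith)
    have b5 : 0 ≤ s * u * v := by positivity
    linarith
  · have q := Q3 a c s ha0 hc0 hs
    have b2 : 0 ≤ (u-v)^2/4*(6*(n-(u+v)-5/4*s)) := mul_nonneg (by positivity) (by linarith)
    linarith

theorem esum_insert (r : ℕ) (s : Finset ℕ) (a : ℕ) (ha : a ∉ s) (x : ℕ → ℝ) :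
    lagPoly ((insert a s).powersetCard (r+1)) x
      = lagPoly (s.powersetCard (r+1)) x + x a * lagPoly (s.powersetCard r) x := by
  unfold lagPoly
  rw [Finset.powersetCard_succ_insert ha, Finset.sum_union, Finset.sum_image, Finset.mul_sum]
  · congr 1
    refine Finset.sum_congr rfl fun e he => ?_
    rw [Finset.mem_powersetCard] at he
    rw [Finset.prod_insert (fun h => ha (he.1 h))]
  · intro e he f hf hef
    have he' := (Finset.mem_powersetCard.1 (Finset.mem_coe.1 he)).1
    have hf' := (Finset.mem_powersetCard.1 (Finset.mem_coe.1 hf)).1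
    have := congrArg (fun g => Finset.erase g a) hef
    simpa [Finset.erase_insert (fun h => ha (he' h)), Finset.erase_insert (fun h => ha (hf' h))]
      using this
  · rw [Finset.disjoint_left]
    intro e he he2
    rw [Finset.mem_image] at he2
    obtain ⟨f, _, rfl⟩ := he2
    exact ha ((Finset.mem_powersetCard.1 he).1 (Finset.mem_insert_self _ _))

theorem e1_eq (s : Finset ℕ) (x : ℕ → ℝ) : lagPoly (s.powersetCard 1) x = ∑ i ∈ s, x i := by
  induction s using Finset.induction_on with
  | empty =>
    rw [Finset.powersetCard_eq_empty.2 (by simp)]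
    simp [lagPoly]
  | insert a s ha ih =>
    rw [esum_insert 0 s a ha, ih, Finset.sum_insert ha]
    simp [lagPoly]; ring

theorem e2_eq (s : Finset ℕ) (x : ℕ → ℝ) :
    2 * lagPoly (s.powersetCard 2) x = (∑ i ∈ s, x i)^2 - ∑ i ∈ s, x i ^ 2 := by
  induction s using Finset.induction_on with
  | empty =>
    rw [Finset.powersetCard_eq_empty.2 (by simp)]
    simp [lagPoly]
  | insert a s ha ih =>
    rw [esum_insert 1 s a ha, Finset.sum_insert ha, Finset.sum_insert ha, e1_eq]
    linear_combination ih

theorem e3_eq (s : Finset ℕ) (x : ℕ → ℝ) :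
    6 * lagPoly (s.powersetCard 3) x
      = (∑ i ∈ s, x i)^3 - 3 * (∑ i ∈ s, x i) * (∑ i ∈ s, x i ^ 2) + 2 * ∑ i ∈ s, x i ^ 3 := by
  induction s using Finset.induction_on with
  | empty =>
    rw [Finset.powersetCard_eq_empty.2 (by simp)]
    simp [lagPoly]
  | insert a s ha ih =>
    rw [esum_insert 2 s a ha, Finset.sum_insert ha, Finset.sum_insert ha, Finset.sum_insert ha]
    linear_combination ih + 3 * x a * e2_eq s x

theorem lag_add_le (E N U : Finset (Finset ℕ)) (x : ℕ → ℝ) (hx : ∀ i, 0 ≤ x i) (hE : E ⊆ U)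
    (hN : N ⊆ U) (hd : ∀ e ∈ N, e ∉ E) : lagPoly E x + lagPoly N x ≤ lagPoly U x := by
  unfold lagPoly
  rw [← Finset.sum_union (Finset.disjoint_right.2 hd)]
  exact Finset.sum_le_sum_of_subset_of_nonneg (Finset.union_subset hE hN)
    fun e _ _ => Finset.prod_nonneg fun i _ => hx i

theorem prod_triple (x : ℕ → ℝ) (a b c : ℕ) (h1 : a < b) (h2 : b < c) :
    ∏ i ∈ ({a, b, c} : Finset ℕ), x i = x a * x b * x c := by
  rw [Finset.prod_insert (by simp; omega), Finset.prod_insert (by simp; omega),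
    Finset.prod_singleton]; ring

theorem mem_triple (a b c t : ℕ) (h1 : a < b) (h2 : b < c) (h3 : c < t) :
    ({a, b, c} : Finset ℕ) ∈ (Finset.range t).powersetCard 3 := by
  rw [Finset.mem_powersetCard]
  constructor
  · intro i; simp; omega
  · exact Finset.card_eq_three.2 ⟨a, b, c, by omega, by omega, by omega, rfl⟩

theorem triple_inj {a b c a' b' c' : ℕ} (h1 : a < b) (h2 : b < c) (h1' : a' < b') (h2' : b' < c')
    (h : ({a, b, c} : Finset ℕ) = {a', b', c'}) : a = a' ∧ b = b' ∧ c = c' := by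
  have m := fun i => congrArg (fun s => i ∈ s) h
  simp only [Finset.mem_insert, Finset.mem_singleton, eq_iff_iff] at m
  have := m a; have := m b; have := m c; have := m a'; have := m b'; have := m c'
  omega

theorem merged (k : ℕ) (x : ℕ → ℝ) (hs : ∑ i ∈ Finset.range (k+2), x i = k + 1) :
    lagPoly ((Finset.range (k+2)).powersetCard 3) x
      = ((k:ℝ)+1)*k*(k-1)/6
        - (∑ i ∈ Finset.range k, psi (k+1) (x i) + psi (k+1) (x k + x (k+1)))/6
        + x k * x (k+1) * ((k:ℝ) + 1 - (x k + x (k+1))) := by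
  have h := e3_eq (Finset.range (k+2)) x
  rw [hs] at h
  rw [Finset.sum_range_succ, Finset.sum_range_succ] at h hs
  rw [Finset.sum_range_succ (fun i => x i ^ 3), Finset.sum_range_succ (fun i => x i ^ 3)] at h
  have hp : ∑ i ∈ Finset.range k, psi (k+1) (x i)
      = 3*((k:ℝ)+1) * (∑ i ∈ Finset.range k, x i ^ 2) - 2 * (∑ i ∈ Finset.range k, x i ^ 3)
        - 6 * k * (∑ i ∈ Finset.range k, x i) + k * (3 * k - 1) := by
    have : ∀ i, psi (k+1) (x i) = 3*((k:ℝ)+1) * x i ^ 2 - 2 * x i ^ 3 - 6 * k * x i + (3 * k - 1) := by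
      intro i; unfold psi; ring
    simp_rw [this]
    rw [Finset.sum_add_distrib, Finset.sum_sub_distrib, Finset.sum_sub_distrib, Finset.mul_sum,
      Finset.mul_sum, Finset.mul_sum]
    simp
    ring
  rw [hp]
  have hA : ∑ i ∈ Finset.range k, x i = k + 1 - x k - x (k+1) := by linarith
  rw [hA]
  unfold psi
  linear_combination h / 6

theorem four_le (k : ℕ) (hk : 4 ≤ k) (f : ℕ → ℝ) (hf : ∀ i ∈ Finset.range k, 0 ≤ f i) :
    f 0 + f 1 + f (k-1) + f (k-2) ≤ ∑ i ∈ Finset.range k, f i := by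
  have : ∑ i ∈ ({0, 1, k-1, k-2} : Finset ℕ), f i ≤ ∑ i ∈ Finset.range k, f i := by
    apply Finset.sum_le_sum_of_subset_of_nonneg
    · intro i; simp; omega
    · exact fun i hi _ => hf i hi
  rw [Finset.sum_insert (by simp; omega), Finset.sum_insert (by simp; omega),
    Finset.sum_insert (by simp; omega), Finset.sum_singleton] at this
  linarith

theorem five_le (k j : ℕ) (hj : 3 ≤ j) (hj2 : j < k - 1) (f : ℕ → ℝ)
    (hf : ∀ i ∈ Finset.range k, 0 ≤ f i) :
    f 0 + f 1 + f 2 + f (k-1) + f j ≤ ∑ i ∈ Finset.range k, f i := by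
  have : ∑ i ∈ ({0, 1, 2, k-1, j} : Finset ℕ), f i ≤ ∑ i ∈ Finset.range k, f i := by
    apply Finset.sum_le_sum_of_subset_of_nonneg
    · intro i; simp; omega
    · exact fun i hi _ => hf i hi
  rw [Finset.sum_insert (by simp; omega), Finset.sum_insert (by simp; omega),
    Finset.sum_insert (by simp; omega), Finset.sum_insert (by simp; omega),
    Finset.sum_singleton] at this
  linarith

/-- the value of the non-edges containing the last two vertices -/
theorem image_sum (b k : ℕ) (x : ℕ → ℝ) :
    lagPoly ((Finset.Ico b k).image (fun a => ({a, k, k+1} : Finset ℕ))) x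
      = x k * x (k+1) * ∑ a ∈ Finset.Ico b k, x a := by
  unfold lagPoly
  rw [Finset.sum_image, Finset.mul_sum]
  · refine Finset.sum_congr rfl fun a ha => ?_
    rw [Finset.mem_Ico] at ha
    rw [prod_triple x a k (k+1) (by omega) (by omega)]; ring
  · intro a ha a' ha' h
    simp only [Finset.coe_Ico, Set.mem_Ico] at ha ha'
    exact (triple_inj (by omega) (by omega) (by omega) (by omega) h).1

theorem core1 (k : ℕ) (hk : 4 ≤ k) (E : Finset (Finset ℕ))
    (hE : E ⊆ (Finset.range (k+2)).powersetCard 3)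
    (h1 : ∀ a, 2 ≤ a → a < k → ({a, k, k+1} : Finset ℕ) ∉ E)
    (h2 : ({k-2, k-1, k} : Finset ℕ) ∉ E) (h3 : ({k-2, k-1, k+1} : Finset ℕ) ∉ E)
    (x : ℕ → ℝ) (hx : ∀ i, 0 ≤ x i) (hs : ∑ i ∈ Finset.range (k+2), x i = k + 1) :
    lagPoly E x ≤ ((k:ℝ)+1)*k*(k-1)/6 - 1/100 := by
  have hadd := lag_add_le E (insert {k-2, k-1, k} (insert {k-2, k-1, k+1}
    ((Finset.Ico 2 k).image (fun a => ({a, k, k+1} : Finset ℕ))))) _ x hx hE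
    (by
      intro e he
      simp only [Finset.mem_insert, Finset.mem_image, Finset.mem_Ico] at he
      rcases he with rfl | rfl | ⟨a, ha, rfl⟩ <;> apply mem_triple <;> omega)
    (by
      intro e he
      simp only [Finset.mem_insert, Finset.mem_image, Finset.mem_Ico] at he
      rcases he with rfl | rfl | ⟨a, ha, rfl⟩
      · exact h2
      · exact h3
      · exact h1 a ha.1 ha.2)
  have hN : lagPoly (insert {k-2, k-1, k} (insert {k-2, k-1, k+1}
    ((Finset.Ico 2 k).image (fun a => ({a, k, k+1} : Finset ℕ))))) x
      = x (k-2) * x (k-1) * x k + (x (k-2) * x (k-1) * x (k+1)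
        + x k * x (k+1) * ∑ a ∈ Finset.Ico 2 k, x a) := by
    rw [← image_sum]
    unfold lagPoly
    rw [Finset.sum_insert, Finset.sum_insert, prod_triple, prod_triple] <;> try omega
    · intro he
      simp only [Finset.mem_image, Finset.mem_Ico] at he
      obtain ⟨a, ha, h⟩ := he
      have := triple_inj (by omega) (by omega) (by omega) (by omega) h
      omega
    · intro he
      simp only [Finset.mem_insert, Finset.mem_image, Finset.mem_Ico] at he
      rcases he with h | ⟨a, ha, h⟩
      · have := triple_inj (by omega) (by omega) (by omega) (by omega) h
        omega
      · have := triple_inj (by omega) (by omega) (by omega) (by omega) h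
        omega
  have hI : ∑ a ∈ Finset.Ico 2 k, x a = k + 1 - (x k + x (k+1)) - x 0 - x 1 := by
    rw [Finset.sum_range_succ, Finset.sum_range_succ,
      ← Finset.sum_range_add_sum_Ico _ (by omega : 2 ≤ k)] at hs
    simp only [Finset.sum_range_succ, Finset.sum_range_zero] at hs
    linarith
  have hle : ∀ i ∈ Finset.range (k+2), x i ≤ k + 1 := fun i hi => by
    rw [← hs]; exact Finset.single_le_sum (fun j _ => hx j) hi
  have hk' : (4:ℝ) ≤ k := by exact_mod_cast hk
  have hm := merged k x hs
  have hp := four_le k hk (fun i => psi (k+1) (x i)) (fun i hi =>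
    psi_nonneg _ _ (by linarith) (hle i (by rw [Finset.mem_range] at hi ⊢; omega)))
  have hq := four_le k hk x (fun i _ => hx i)
  have hs' := hs
  rw [Finset.sum_range_succ, Finset.sum_range_succ] at hs'
  have hsc := scal1 (k+1) (x 0) (x 1) (x (k-1)) (x (k-2)) (x k + x (k+1)) (by linarith)
    (hx _) (hx _) (hx _) (hx _) (add_nonneg (hx _) (hx _)) (by linarith)
  rw [hN, hI, hm] at hadd
  have hyz : 0 ≤ (x 0 + x 1) * (x k - x (k+1))^2 :=
    mul_nonneg (add_nonneg (hx _) (hx _)) (sq_nonneg _)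
  linarith

theorem core2 (k : ℕ) (hk : 6 ≤ k) (E : Finset (Finset ℕ))
    (hE : E ⊆ (Finset.range (k+2)).powersetCard 3)
    (h1 : ∀ a, 3 ≤ a → a < k → ({a, k, k+1} : Finset ℕ) ∉ E)
    (h2 : ({k-2, k-1, k} : Finset ℕ) ∉ E) (h3 : ({k-2, k-1, k+1} : Finset ℕ) ∉ E)
    (h4 : ({k-3, k-1, k+1} : Finset ℕ) ∉ E)
    (x : ℕ → ℝ) (hx : ∀ i, 0 ≤ x i) (hs : ∑ i ∈ Finset.range (k+2), x i = k + 1) :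
    lagPoly E x ≤ ((k:ℝ)+1)*k*(k-1)/6 - 1/100 := by
  have hadd := lag_add_le E (insert {k-3, k-1, k+1} (insert {k-2, k-1, k} (insert {k-2, k-1, k+1}
    ((Finset.Ico 3 k).image (fun a => ({a, k, k+1} : Finset ℕ)))))) _ x hx hE
    (by
      intro e he
      simp only [Finset.mem_insert, Finset.mem_image, Finset.mem_Ico] at he
      rcases he with rfl | rfl | rfl | ⟨a, ha, rfl⟩ <;> apply mem_triple <;> omega)
    (by
      intro e he
      simp only [Finset.mem_insert, Finset.mem_image, Finset.mem_Ico] at he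
      rcases he with rfl | rfl | rfl | ⟨a, ha, rfl⟩
      · exact h4
      · exact h2
      · exact h3
      · exact h1 a ha.1 ha.2)
  have hN : lagPoly (insert {k-3, k-1, k+1} (insert {k-2, k-1, k} (insert {k-2, k-1, k+1}
    ((Finset.Ico 3 k).image (fun a => ({a, k, k+1} : Finset ℕ)))))) x
      = x (k-3) * x (k-1) * x (k+1) + (x (k-2) * x (k-1) * x k + (x (k-2) * x (k-1) * x (k+1)
        + x k * x (k+1) * ∑ a ∈ Finset.Ico 3 k, x a)) := by
    rw [← image_sum]
    unfold lagPoly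
    rw [Finset.sum_insert, Finset.sum_insert, Finset.sum_insert, prod_triple, prod_triple,
      prod_triple] <;> try omega
    · intro he
      simp only [Finset.mem_image, Finset.mem_Ico] at he
      obtain ⟨a, ha, h⟩ := he
      have := triple_inj (by omega) (by omega) (by omega) (by omega) h
      omega
    · intro he
      simp only [Finset.mem_insert, Finset.mem_image, Finset.mem_Ico] at he
      rcases he with h | ⟨a, ha, h⟩
      · have := triple_inj (by omega) (by omega) (by omega) (by omega) h
        omega
      · have := triple_inj (by omega) (by omega) (by omega) (by omega) h
        omega
    · intro he
      simp only [Finset.mem_insert, Finset.mem_image, Finset.mem_Ico] at he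
      rcases he with h | h | ⟨a, ha, h⟩
      · have := triple_inj (by omega) (by omega) (by omega) (by omega) h
        omega
      · have := triple_inj (by omega) (by omega) (by omega) (by omega) h
        omega
      · have := triple_inj (by omega) (by omega) (by omega) (by omega) h
        omega
  have hI : ∑ a ∈ Finset.Ico 3 k, x a = k + 1 - (x k + x (k+1)) - x 0 - x 1 - x 2 := by
    rw [Finset.sum_range_succ, Finset.sum_range_succ,
      ← Finset.sum_range_add_sum_Ico _ (by omega : 3 ≤ k)] at hs
    simp only [Finset.sum_range_succ, Finset.sum_range_zero] at hs
    linarith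
  have hle : ∀ i ∈ Finset.range (k+2), x i ≤ k + 1 := fun i hi => by
    rw [← hs]; exact Finset.single_le_sum (fun j _ => hx j) hi
  have hk' : (6:ℝ) ≤ k := by exact_mod_cast hk
  have hm := merged k x hs
  have hpn : ∀ i ∈ Finset.range k, 0 ≤ psi (k+1) (x i) := fun i hi =>
    psi_nonneg _ _ (by linarith) (hle i (by rw [Finset.mem_range] at hi ⊢; omega))
  have hs' := hs
  rw [Finset.sum_range_succ, Finset.sum_range_succ] at hs'
  rw [hN, hI, hm] at hadd
  have hy := hx k
  have hz := hx (k+1)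
  have hu := hx (k-1)
  have hv := hx (k-2)
  have hqq := hx (k-3)
  have hX : 0 ≤ x 0 + x 1 + x 2 := add_nonneg (add_nonneg (hx _) (hx _)) (hx _)
  rcases le_total (x (k-1) * x (k-3)) ((x 0 + x 1 + x 2) * (x k + x (k+1))) with hc | hc
  · -- the main case
    have hgain : (x 0 + x 1 + x 2) * (x k * x (k+1)) - x (k-3) * x (k-1) * x (k+1)
        ≤ (x 0 + x 1 + x 2) * (x k + x (k+1))^2/4
          - (x k + x (k+1)) * x (k-1) * x (k-3) / 4 := by
      generalize x 0 + x 1 + x 2 = X at *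
      generalize x k = y at *
      generalize x (k+1) = z at *
      generalize x (k-1) = u at *
      generalize x (k-3) = q at *
      have hp : 0 ≤ u * q := mul_nonneg hu hqq
      have e : (u * q) * (3*z - y) + X * (y-z)^2 ≥ 0 := by
        generalize u * q = p at *
        rcases le_total y (3*z) with h | h
        · have := mul_nonneg hp (sub_nonneg.2 h)
          have := mul_nonneg hX (sq_nonneg (y-z))
          nlinarith
        · have := mul_nonneg (sub_nonneg.2 hc) (sub_nonneg.2 h)
          have := mul_nonneg hX (mul_nonneg hz hz)
          nlinarith [mul_nonneg hX (sq_nonneg (y-z)), mul_nonneg hX (mul_nonneg hy hz)]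
      linarith
    have hs0 : 0 ≤ x k + x (k+1) := add_nonneg hy hz
    have hsu : 0 ≤ (x k + x (k+1)) * x (k-1) := mul_nonneg hs0 hu
    rcases le_total (x (k-2)) (x (k-3)) with hvq | hvq
    · have hp := five_le k (k-2) (by omega) (by omega) _ hpn
      have hq := five_le k (k-2) (by omega) (by omega) x (fun i _ => hx i)
      have hsc := scal2 (k+1) (x 0) (x 1) (x 2) (x (k-1)) (x (k-2)) (x k + x (k+1)) (by linarith)
        (hx _) (hx _) (hx _) (hx _) (hx _) hs0 (by linarith)
      have := mul_le_mul_of_nonneg_left hvq hsu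
      linarith
    · have hp := five_le k (k-3) (by omega) (by omega) _ hpn
      have hq := five_le k (k-3) (by omega) (by omega) x (fun i _ => hx i)
      have hsc := scal2 (k+1) (x 0) (x 1) (x 2) (x (k-1)) (x (k-3)) (x k + x (k+1)) (by linarith)
        (hx _) (hx _) (hx _) (hx _) (hx _) hs0 (by linarith)
      have := mul_le_mul_of_nonneg_left hvq hsu
      linarith
  · have hp := four_le k (by omega) (fun i => psi (k+1) (x i)) hpn
    have hq := four_le k (by omega) x (fun i _ => hx i)
    have hsc := scal1 (k+1) (x 0) (x 1) (x (k-1)) (x (k-2)) (x k + x (k+1)) (by linarith)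
      (hx _) (hx _) (hx _) (hx _) (add_nonneg (hx _) (hx _)) (by linarith)
    have hyz : 0 ≤ (x 0 + x 1) * (x k + x (k+1))^2 :=
      mul_nonneg (add_nonneg (hx _) (hx _)) (sq_nonneg _)
    have hz2 := mul_le_mul_of_nonneg_left hc hz
    have hz3 := mul_nonneg hX (mul_nonneg hz hz)
    linarith

theorem core0 (E : Finset (Finset ℕ))
    (hE : E ⊆ (Finset.range 5).powersetCard 3)
    (h1 : ({1, 2, 3} : Finset ℕ) ∉ E) (h2 : ({1, 2, 4} : Finset ℕ) ∉ E)
    (h3 : ({1, 3, 4} : Finset ℕ) ∉ E) (h4 : ({2, 3, 4} : Finset ℕ) ∉ E)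
    (x : ℕ → ℝ) (hx : ∀ i, 0 ≤ x i) (hs : ∑ i ∈ Finset.range 5, x i = 4) :
    lagPoly E x ≤ 4 - 1/100 := by
  have hadd := lag_add_le E ({{1, 2, 3}, {1, 2, 4}, {1, 3, 4}, {2, 3, 4}}) _ x hx hE
    (by decide)
    (by
      intro e he
      simp only [Finset.mem_insert, Finset.mem_singleton] at he
      rcases he with rfl | rfl | rfl | rfl <;> assumption)
  have hN : lagPoly ({{1, 2, 3}, {1, 2, 4}, {1, 3, 4}, {2, 3, 4}}) x
     = x 1 * x 2 * x 3 + (x 1 * x 2 * x 4 + (x 1 * x 3 * x 4 + x 2 * x 3 * x 4)) := by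
    unfold lagPoly
    rw [Finset.sum_insert (by decide), Finset.sum_insert (by decide), Finset.sum_insert (by decide),
      Finset.sum_singleton, prod_triple, prod_triple, prod_triple, prod_triple] <;> norm_num
  have h := e3_eq (Finset.range 5) x
  simp only [Finset.sum_range_succ, Finset.sum_range_zero] at h hs
  rw [hN] at hadd
  have h6 : lagPoly ((Finset.range 5).powersetCard 3) x
    - (x 1 * x 2 * x 3 + (x 1 * x 2 * x 4 + (x 1 * x 3 * x 4 + x 2 * x 3 * x 4)))
    = x 0 * (x 1 * x 2 + x 1 * x 3 + x 1 * x 4 + x 2 * x 3 + x 2 * x 4 + x 3 * x 4) := by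
    linear_combination h / 6
  have h7 : x 1 * x 2 + x 1 * x 3 + x 1 * x 4 + x 2 * x 3 + x 2 * x 4 + x 3 * x 4
      ≤ 3/8 * (x 1 + x 2 + x 3 + x 4)^2 := by
    nlinarith [sq_nonneg (x 1 - x 2), sq_nonneg (x 1 - x 3), sq_nonneg (x 1 - x 4),
      sq_nonneg (x 2 - x 3), sq_nonneg (x 2 - x 4), sq_nonneg (x 3 - x 4)]
  have h8 : x 1 + x 2 + x 3 + x 4 = 4 - x 0 := by linarith
  rw [h8] at h7
  have h9 := mul_le_mul_of_nonneg_left h7 (hx 0)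
  have h10 : x 0 ≤ 4 := by linarith [hx 1, hx 2, hx 3, hx 4]
  have h11 : x 0 * (3/8 * (4 - x 0)^2) ≤ 3.9 := by
    nlinarith [mul_nonneg (hx 0) (sq_nonneg (x 0 - 4/3)), mul_nonneg (sub_nonneg.2 h10) (sq_nonneg (x 0 - 4/3)), sq_nonneg (x 0 - 4/3)]
  linarith

theorem exists_triple (e : Finset ℕ) (he : e.card = 3) :
    ∃ a b c, a < b ∧ b < c ∧ e = {a, b, c} := by
  obtain ⟨x, y, z, hxy, hxz, hyz, rfl⟩ := Finset.card_eq_three.1 he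
  rcases lt_or_gt_of_ne hxy with h1 | h1 <;> rcases lt_or_gt_of_ne hxz with h2 | h2 <;>
    rcases lt_or_gt_of_ne hyz with h3 | h3
  · exact ⟨x, y, z, h1, h3, rfl⟩
  · exact ⟨x, z, y, h2, h3, by ext i; simp; omega⟩
  · omega
  · exact ⟨z, x, y, h2, h1, by ext i; simp; omega⟩
  · exact ⟨y, x, z, h1, h2, by ext i; simp; omega⟩
  · omega
  · exact ⟨y, z, x, h3, h2, by ext i; simp; omega⟩
  · exact ⟨z, y, x, h3, h1, by ext i; simp; omega⟩

theorem lc_dom {E : Finset (Finset ℕ)} (hlc : LeftCompressed E) {a b c a' b' c' : ℕ}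
    (h : ({a, b, c} : Finset ℕ) ∈ E) (h1 : a < b) (h2 : b < c) (h1' : a' < b') (h2' : b' < c')
    (ha : a' ≤ a) (hb : b' ≤ b) (hc : c' ≤ c) : ({a', b', c'} : Finset ℕ) ∈ E := by
  have s1 : ({a', b, c} : Finset ℕ) ∈ E := by
    rcases ha.eq_or_lt with rfl | ha
    · exact h
    · have := hlc _ h a (by simp) a' ha (by simp; omega)
      convert this using 1
      ext i; simp; omega
  have s2 : ({a', b', c} : Finset ℕ) ∈ E := by
    rcases hb.eq_or_lt with rfl | hb
    · exact s1
    · have := hlc _ s1 b (by simp) b' hb (by simp; omega)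
      convert this using 1
      ext i; simp; omega
  rcases hc.eq_or_lt with rfl | hc
  · exact s2
  · have := hlc _ s2 c (by simp) c' hc (by simp; omega)
    convert this using 1
    ext i; simp; omega

theorem rank_card {α : Type*} (S : Finset α) (f : α → ℕ) (hf : Function.Injective f) (m : ℕ)
    (hm : m ≤ S.card) :
    m ≤ (S.filter (fun A => (S.filter (fun B => f B < f A)).card < m)).card := by
  classical
  have hinj : Set.InjOn (fun A => (S.filter (fun B => f B < f A)).card) S := by
    intro A hA B hB hAB
    by_contra hne
    have key : ∀ A ∈ S, ∀ B ∈ S, f A < f B →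
        (S.filter (fun C => f C < f A)).card < (S.filter (fun C => f C < f B)).card := by
      intro A hA B hB hlt
      apply Finset.card_lt_card
      rw [Finset.ssubset_iff_of_subset]
      · exact ⟨A, by simp [hA, hlt], by simp⟩
      · intro C hC
        simp only [Finset.mem_filter] at hC ⊢
        exact ⟨hC.1, by omega⟩
    simp only at hAB
    rcases lt_or_gt_of_ne (fun h => hne (hf h)) with h | h
    · have := key A hA B hB h; omega
    · have := key B hB A hA h; omega
  have himg : S.image (fun A => (S.filter (fun B => f B < f A)).card) = Finset.range S.card := by
    apply Finset.eq_of_subset_of_card_le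
    · intro r hr
      rw [Finset.mem_image] at hr
      obtain ⟨A, hA, rfl⟩ := hr
      rw [Finset.mem_range]
      apply Finset.card_lt_card
      rw [Finset.ssubset_iff_of_subset (Finset.filter_subset _ _)]
      exact ⟨A, hA, by simp⟩
    · rw [Finset.card_image_of_injOn hinj, Finset.card_range]
  have hsub : Finset.range m ⊆
      (S.filter (fun A => (S.filter (fun B => f B < f A)).card < m)).image
        (fun A => (S.filter (fun B => f B < f A)).card) := by
    intro r hr
    rw [Finset.mem_range] at hr
    have : r ∈ S.image (fun A => (S.filter (fun B => f B < f A)).card) := by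
      rw [himg, Finset.mem_range]; omega
    rw [Finset.mem_image] at this ⊢
    obtain ⟨A, hA, rfl⟩ := this
    exact ⟨A, by rw [Finset.mem_filter]; exact ⟨hA, hr⟩, rfl⟩
  have := Finset.card_le_card hsub
  rw [Finset.card_range] at this
  exact this.trans Finset.card_image_le

theorem le_choose_three (m : ℕ) : m ≤ (3 + m).choose 3 := by
  induction m with
  | zero => simp
  | succ m ih =>
    have e : (3+m+1).choose 3 = (3+m).choose 2 + (3+m).choose 3 := Nat.choose_succ_succ _ _
    rw [← Nat.add_assoc, e]
    have := Nat.choose_pos (show 2 ≤ 3 + m by omega)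
    omega

theorem card_colex (m : ℕ) : m ≤ (colexGraph 3 m).card := by
  unfold colexGraph
  apply rank_card _ binVal (Finset.geomSum_injective le_rfl)
  rw [Finset.card_powersetCard, Finset.card_range]
  exact le_choose_three m

/-- all triples avoiding the pair of the two last vertices -/
def avoidLast (k : ℕ) : Finset (Finset ℕ) :=
  (Finset.range (k+1)).powersetCard 3 ∪ ((Finset.range k).powersetCard 2).image (insert (k+1))

theorem card_avoidLast (k : ℕ) : (avoidLast k).card = (k+1).choose 3 + k.choose 2 := by
  unfold avoidLast
  rw [Finset.card_union_of_disjoint, Finset.card_image_of_injOn]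
  · simp
  · intro e he f hf hef
    have he' := (Finset.mem_powersetCard.1 (Finset.mem_coe.1 he)).1
    have hf' := (Finset.mem_powersetCard.1 (Finset.mem_coe.1 hf)).1
    have h1 : k + 1 ∉ e := fun h => by have := Finset.mem_range.1 (he' h); omega
    have h2 : k + 1 ∉ f := fun h => by have := Finset.mem_range.1 (hf' h); omega
    have := congrArg (fun g => Finset.erase g (k+1)) hef
    simpa [Finset.erase_insert h1, Finset.erase_insert h2] using this
  · rw [Finset.disjoint_left]
    intro e he he2
    rw [Finset.mem_image] at he2
    obtain ⟨f, _, rfl⟩ := he2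
    have := Finset.mem_range.1 ((Finset.mem_powersetCard.1 he).1 (Finset.mem_insert_self _ _))
    omega

theorem mem_avoidLast {k : ℕ} {e : Finset ℕ} (he : e ∈ avoidLast k) :
    ∃ p q r, p < q ∧ q < r ∧ e = {p, q, r} ∧ (r ≤ k ∨ (r = k + 1 ∧ q < k)) := by
  unfold avoidLast at he
  rw [Finset.mem_union] at he
  rcases he with he | he
  · rw [Finset.mem_powersetCard] at he
    obtain ⟨p, q, r, h1, h2, rfl⟩ := exists_triple e he.2
    have := Finset.mem_range.1 (he.1 (by simp : r ∈ ({p, q, r} : Finset ℕ)))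
    exact ⟨p, q, r, h1, h2, rfl, Or.inl (by omega)⟩
  · rw [Finset.mem_image] at he
    obtain ⟨f, hf, rfl⟩ := he
    rw [Finset.mem_powersetCard] at hf
    obtain ⟨p, q, hpq, rfl⟩ := Finset.card_eq_two.1 hf.2
    have h1 := Finset.mem_range.1 (hf.1 (by simp : p ∈ ({p, q} : Finset ℕ)))
    have h2 := Finset.mem_range.1 (hf.1 (by simp : q ∈ ({p, q} : Finset ℕ)))
    rcases lt_or_gt_of_ne hpq with h | h
    · exact ⟨p, q, k+1, h, by omega, by ext i; simp; omega, Or.inr ⟨rfl, h2⟩⟩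
    · exact ⟨q, p, k+1, h, by omega, by ext i; simp; omega, Or.inr ⟨rfl, h1⟩⟩

theorem binVal_triple (a b c : ℕ) (h1 : a < b) (h2 : b < c) :
    binVal {a, b, c} = 2^a + 2^b + 2^c := by
  unfold binVal
  rw [Finset.sum_insert (by simp; omega), Finset.sum_insert (by simp; omega),
    Finset.sum_singleton]; ring

theorem two_pow_aux {p q k : ℕ} (h1 : p < q) (h2 : q < k) : 2^p + 2^q < 2^k := by
  have a1 : 2^p < 2^q := Nat.pow_lt_pow_right (by norm_num) h1
  have a2 : 2^(q+1) ≤ 2^k := Nat.pow_le_pow_right (by norm_num) h2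
  rw [pow_succ] at a2
  omega

theorem not_colex (k m a : ℕ) (ha : a < k) (hm : m ≤ (k+1).choose 3 + k.choose 2) :
    ({a, k, k+1} : Finset ℕ) ∉ colexGraph 3 m := by
  intro h
  unfold colexGraph at h
  rw [Finset.mem_filter, Finset.mem_powersetCard] at h
  have hk := Finset.mem_range.1 (h.1.1 (by simp : k + 1 ∈ ({a, k, k+1} : Finset ℕ)))
  have hsub : avoidLast k ⊆ ((Finset.range (3 + m)).powersetCard 3).filter
      (fun B => binVal B < binVal {a, k, k+1}) := by
    intro e he
    obtain ⟨p, q, r, h1, h2, rfl, h3⟩ := mem_avoidLast he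
    rw [Finset.mem_filter]
    refine ⟨mem_triple _ _ _ _ h1 h2 (by omega), ?_⟩
    rw [binVal_triple _ _ _ h1 h2, binVal_triple _ _ _ ha (by omega)]
    have b0 : 0 < 2^a := by positivity
    have b1 : 2^(k+1) = 2 * 2^k := by rw [pow_succ]; ring
    rcases h3 with h3 | ⟨rfl, h3⟩
    · have c1 := two_pow_aux h1 h2
      have c2 : 2^r ≤ 2^k := Nat.pow_le_pow_right (by norm_num) h3
      omega
    · have c1 := two_pow_aux h1 h3
      omega
  have := Finset.card_le_card hsub
  rw [card_avoidLast] at this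
  have := h.2
  omega

theorem four_edges (k m : ℕ) (hk : 4 ≤ k) (E : Finset (Finset ℕ)) (hmE : E.card = m)
    (hlc : LeftCompressed E) (hm : m ≤ (k+1).choose 3 + k.choose 2)
    (hsd : ((E \ colexGraph 3 m) ∪ (colexGraph 3 m \ E)).card ≤ 6) :
    ({3, k, k+1} : Finset ℕ) ∉ E := by
  intro h
  have hsub : (Finset.range 4).image (fun a => ({a, k, k+1} : Finset ℕ)) ⊆ E \ colexGraph 3 m := by
    intro e he
    rw [Finset.mem_image] at he
    obtain ⟨a, ha, rfl⟩ := he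
    rw [Finset.mem_range] at ha
    rw [Finset.mem_sdiff]
    exact ⟨lc_dom hlc h (by omega) (by omega) (by omega) (by omega) (by omega) le_rfl le_rfl,
      not_colex k m a (by omega) hm⟩
  have h4 := Finset.card_le_card hsub
  rw [Finset.card_image_of_injOn, Finset.card_range] at h4
  · rw [Finset.card_union_of_disjoint] at hsd
    · have e1 := Finset.card_sdiff_add_card_inter E (colexGraph 3 m)
      have e2 := Finset.card_sdiff_add_card_inter (colexGraph 3 m) E
      rw [Finset.inter_comm] at e2
      have := card_colex m
      omega
    · rw [Finset.disjoint_left]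
      intro e he he2
      exact (Finset.mem_sdiff.1 he2).2 (Finset.mem_sdiff.1 he).1
  · intro a ha a' ha' hh
    simp only [Finset.coe_range, Set.mem_Iio] at ha ha'
    exact (triple_inj (by omega) (by omega) (by omega) (by omega) hh).1

theorem second_pair (k : ℕ) (hk : 5 ≤ k) (E : Finset (Finset ℕ))
    (hlc : LeftCompressed E) (hm : E.card ≤ (k+1).choose 3 + k.choose 2)
    (h2 : ({2, k, k+1} : Finset ℕ) ∈ E) : ({k-3, k-1, k+1} : Finset ℕ) ∉ E := by
  intro h
  have hsub : (avoidLast k \ {{k-2, k-1, k}, {k-2, k-1, k+1}}) ∪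
      (Finset.range 3).image (fun a => ({a, k, k+1} : Finset ℕ)) ⊆ E := by
    intro e he
    rw [Finset.mem_union, Finset.mem_sdiff, Finset.mem_image] at he
    rcases he with ⟨he, hne⟩ | ⟨a, ha, rfl⟩
    · obtain ⟨p, q, r, h1, h2, rfl, h3⟩ := mem_avoidLast he
      by_cases hp : p ≤ k - 3
      · exact lc_dom hlc h (by omega) (by omega) h1 h2 hp (by omega) (by omega)
      · exfalso
        apply hne
        have hp' : p = k - 2 := by omega
        have hq' : q = k - 1 := by omega
        subst hp' hq'
        rcases h3 with h3 | ⟨rfl, _⟩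
        · have : r = k := by omega
          subst this
          simp
        · simp
    · rw [Finset.mem_range] at ha
      exact lc_dom hlc h2 (by omega) (by omega) (by omega) (by omega) (by omega) le_rfl le_rfl
  have hc := Finset.card_le_card hsub
  rw [Finset.card_union_of_disjoint, Finset.card_image_of_injOn, Finset.card_range] at hc
  · have h5 := Finset.le_card_sdiff ({{k-2, k-1, k}, {k-2, k-1, k+1}} : Finset (Finset ℕ)) (avoidLast k)
    have h6 := Finset.card_le_two (a := ({k-2, k-1, k} : Finset ℕ)) (b := {k-2, k-1, k+1})
    rw [card_avoidLast] at h5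
    omega
  · intro a ha a' ha' hh
    simp only [Finset.coe_range, Set.mem_Iio] at ha ha'
    exact (triple_inj (by omega) (by omega) (by omega) (by omega) hh).1
  · rw [Finset.disjoint_left]
    intro e he he2
    rw [Finset.mem_image] at he2
    obtain ⟨a, ha, rfl⟩ := he2
    rw [Finset.mem_range] at ha
    obtain ⟨p, q, r, h1, h2, hh, h3⟩ := mem_avoidLast (Finset.mem_sdiff.1 he).1
    have := triple_inj (by omega) (by omega) h1 h2 hh
    omega

theorem lag_complete_ge_s13 (k : ℕ) :
    ((k:ℝ)+1)*k*(k-1)/6 / ((k:ℝ)+1)^3 ≤ lag (completeG (k+1) 3) := by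
  have hk : (0:ℝ) < (k:ℝ) + 1 := by positivity
  apply le_csSup
  · refine ⟨((completeG (k+1) 3).card : ℝ), ?_⟩
    rintro y ⟨n, w, ⟨h1, h2, h3⟩, rfl⟩
    unfold lagPoly
    have : ∀ e ∈ completeG (k+1) 3, ∏ i ∈ e, w i ≤ 1 := by
      intro e _
      apply Finset.prod_le_one (fun i _ => h1 i)
      intro i _
      rcases lt_or_ge i n with h | h
      · rw [← h3]; exact Finset.single_le_sum (fun j _ => h1 j) (Finset.mem_range.2 h)
      · rw [h2 i h]; norm_num
    have := Finset.sum_le_card_nsmul _ _ _ this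
    simpa using this
  · refine ⟨k+1, fun i => if i < k+1 then 1/((k:ℝ)+1) else 0, ⟨?_, ?_, ?_⟩, ?_⟩
    · intro i; dsimp only; split_ifs <;> positivity
    · intro i hi; simp [not_lt.2 hi]
    · rw [Finset.sum_congr rfl (g := fun _ => 1/((k:ℝ)+1))
        (fun i hi => by simp [Finset.mem_range.1 hi])]
      simp
      field_simp
    · have h := e3_eq (Finset.range (k+1)) (fun i => if i < k+1 then 1/((k:ℝ)+1) else 0)
      have s1 : ∑ i ∈ Finset.range (k+1), (if i < k+1 then 1/((k:ℝ)+1) else 0)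
          = ∑ _i ∈ Finset.range (k+1), (1/((k:ℝ)+1)) :=
        Finset.sum_congr rfl (fun i hi => by rw [if_pos (Finset.mem_range.1 hi)])
      have s2 : ∑ i ∈ Finset.range (k+1), (if i < k+1 then 1/((k:ℝ)+1) else 0)^2
          = ∑ _i ∈ Finset.range (k+1), (1/((k:ℝ)+1))^2 :=
        Finset.sum_congr rfl (fun i hi => by rw [if_pos (Finset.mem_range.1 hi)])
      have s3 : ∑ i ∈ Finset.range (k+1), (if i < k+1 then 1/((k:ℝ)+1) else 0)^3
          = ∑ _i ∈ Finset.range (k+1), (1/((k:ℝ)+1))^3 :=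
        Finset.sum_congr rfl (fun i hi => by rw [if_pos (Finset.mem_range.1 hi)])
      rw [s1, s2, s3] at h
      simp only [Finset.sum_const, Finset.card_range, nsmul_eq_mul] at h
      push_cast at h
      unfold completeG
      have h' : ((k:ℝ)+1)*k*(k-1)/6 / ((k:ℝ)+1)^3 = ((((k:ℝ) + 1) * (1 / (k + 1))) ^ 3 - 3 * ((k + 1) * (1 / (k + 1))) * ((k + 1) * (1 / (k + 1)) ^ 2) + 2 * ((k + 1) * (1 / (k + 1)) ^ 3)) / 6 := by
        field_simp
        ring
      rw [h', ← h]; ring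

theorem finish (k : ℕ) (E : Finset (Finset ℕ))
    (hE : E ⊆ (Finset.range (k+2)).powersetCard 3)
    (hB : ∀ x : ℕ → ℝ, (∀ i, 0 ≤ x i) → ∑ i ∈ Finset.range (k+2), x i = k + 1 →
      lagPoly E x ≤ ((k:ℝ)+1)*k*(k-1)/6 - 1/100) :
    lag E < lag (completeG (k+1) 3) := by
  have hk : (0:ℝ) < (k:ℝ) + 1 := by positivity
  refine lt_of_le_of_lt (b := (((k:ℝ)+1)*k*(k-1)/6 - 1/100) / ((k:ℝ)+1)^3) ?_
    (lt_of_lt_of_le ?_ (lag_complete_ge_s13 k))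
  · apply csSup_le
    · refine ⟨_, 1, fun i => if i = 0 then 1 else 0, ⟨?_, ?_, ?_⟩, rfl⟩
      · intro i; dsimp only; split_ifs <;> norm_num
      · intro i hi; simp; omega
      · simp
    · rintro y ⟨n, w, ⟨h1, h2, h3⟩, rfl⟩
      have hS : ∑ i ∈ Finset.range (k+2), w i ≤ 1 := by
        rw [← h3]
        rcases le_total (k+2) n with h | h
        · exact Finset.sum_le_sum_of_subset_of_nonneg (Finset.range_subset_range.2 h)
            (fun i _ _ => h1 i)
        · apply le_of_eq
          symm
          apply Finset.sum_subset (Finset.range_subset_range.2 h)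
          intro i _ hi
          exact h2 i (by simpa using hi)
      have hb := hB (fun i => ((k:ℝ)+1) * (w i + if i = 0 then
          1 - ∑ i ∈ Finset.range (k+2), w i else 0))
        (by
          intro i
          apply mul_nonneg hk.le
          have := h1 i
          split_ifs <;> linarith)
        (by
          rw [← Finset.mul_sum, Finset.sum_add_distrib, Finset.sum_ite_eq']
          simp)
      rw [le_div_iff₀ (by positivity)]
      refine le_trans ?_ hb
      unfold lagPoly
      rw [Finset.sum_mul]
      apply Finset.sum_le_sum
      intro e he
      rw [Finset.prod_mul_distrib, Finset.prod_const, (Finset.mem_powersetCard.1 (hE he)).2,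
        mul_comm]
      apply mul_le_mul_of_nonneg_left _ (by positivity)
      apply Finset.prod_le_prod (fun i _ => h1 i)
      intro i _
      split_ifs <;> linarith
  · apply div_lt_div_of_pos_right _ (by positivity)
    linarith

/-- A left-compressed 3-graph on [t] with m edges, no clique of order t-1, whose
edge set differs from C_{3,m} in at most 6 edges, satisfies λ(G) < λ([t-1]^{(3)}). -/
theorem stmt_13 (m t : ℕ) (hm : 0 < m) (ht : 0 < t)
    (h₁ : (t - 1).choose 3 ≤ m)
    (h₂ : m ≤ (t - 1).choose 3 + (t - 2).choose 2)
    (E : Finset (Finset ℕ)) (hE : E ⊆ (Finset.range t).powersetCard 3)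
    (hmE : E.card = m) (hlc : LeftCompressed E)
    (hnoK : ¬ ∃ s : Finset ℕ, s.card = t - 1 ∧ s.powersetCard 3 ⊆ E)
    (hsd : ((E \ colexGraph 3 m) ∪ (colexGraph 3 m \ E)).card ≤ 6) :
    lag E < lag (completeG (t - 1) 3) := by
  by_cases ht4 : t < 4
  · exfalso
    interval_cases t <;> simp [Nat.choose] at h₂ <;> omega
  obtain ⟨k, rfl⟩ : ∃ k, t = k + 2 := ⟨t - 2, by omega⟩
  have hk : 2 ≤ k := by omega
  simp only [Nat.add_sub_cancel, show k + 2 - 1 = k + 1 by omega] at *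
  have htop : ({k-2, k-1, k} : Finset ℕ) ∉ E := by
    intro h
    apply hnoK
    refine ⟨Finset.range (k+1), by simp, ?_⟩
    intro e he
    rw [Finset.mem_powersetCard] at he
    obtain ⟨p, q, r, h1, h2, rfl⟩ := exists_triple e he.2
    have := Finset.mem_range.1 (he.1 (by simp : r ∈ ({p, q, r} : Finset ℕ)))
    exact lc_dom hlc h (by omega) (by omega) h1 h2 (by omega) (by omega) (by omega)
  have htop' : ({k-2, k-1, k+1} : Finset ℕ) ∉ E := fun h =>
    htop (lc_dom hlc h (by omega) (by omega) (by omega) (by omega) le_rfl le_rfl (by omega))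
  rcases (show k = 2 ∨ k = 3 ∨ 4 ≤ k by omega) with rfl | rfl | hk4
  · exfalso
    obtain ⟨e, he⟩ := Finset.card_pos.1 (hmE ▸ hm)
    obtain ⟨p, q, r, h1, h2, rfl⟩ := exists_triple e (Finset.mem_powersetCard.1 (hE he)).2
    exact htop (lc_dom hlc he h1 h2 (by omega) (by omega) (by omega) (by omega) (by omega))
  · apply finish 3 E hE
    intro x hx hs
    have := core0 E hE htop
      (fun h => htop (lc_dom hlc h (by omega) (by omega) (by omega) (by omega)
        (by omega) (by omega) (by omega)))
      (fun h => htop (lc_dom hlc h (by omega) (by omega) (by omega) (by omega)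
        (by omega) (by omega) (by omega)))
      (fun h => htop (lc_dom hlc h (by omega) (by omega) (by omega) (by omega)
        (by omega) (by omega) (by omega))) x hx (by rw [hs]; norm_num)
    norm_num at this ⊢
    linarith
  · apply finish k E hE
    intro x hx hs
    have h3 := four_edges k m hk4 E hmE hlc h₂ hsd
    by_cases h2 : ({2, k, k+1} : Finset ℕ) ∈ E
    · have hk5 : 5 ≤ k := by
        by_contra hlt
        exact htop (lc_dom hlc h2 (by omega) (by omega) (by omega) (by omega)
          (by omega) (by omega) (by omega))
      have hsp := second_pair k hk5 E hlc (by omega) h2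
      have hk6 : 6 ≤ k := by
        by_contra hlt
        exact hsp (lc_dom hlc h2 (by omega) (by omega) (by omega) (by omega)
          (by omega) (by omega) (by omega))
      exact core2 k hk6 E hE (fun a ha hak h => h3 (lc_dom hlc h (by omega) (by omega) (by omega)
        (by omega) ha le_rfl le_rfl)) htop htop' hsp x hx hs
    · exact core1 k hk4 E hE (fun a ha hak h => h2 (lc_dom hlc h (by omega) (by omega) (by omega)
        (by omega) ha le_rfl le_rfl)) htop htop' x hx hs
end
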